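/- Extension of normal cb maps through a type I factor: if N ⊆ B(L) = F is a von Neumann subalgebra of a type I factor F and π : N → B(H) is a completely bounded normal map, then π extends to a completely bounded normal map π~ : F → B(H). Concretely, writing the normal homomorphism ρ in the factorization π = V₁* ρ(·) V₂ as ρ(a) = U*(a ⊗ I)U for an isometry U : K → L ⊗ L̂ (amplification–induction–spatial form of a normal representation of B(L) restricted to N), the map π~(f) := V₁* U* (f ⊗ I) U V₂ is normal, completely bounded, and restricts to π on N. -/

import Mathlib

open scoped ComplexInnerProductSpace

/-- A functional on (a subset `M` of) `B(H₀)` is normal iff it is a σ-weakly continuous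
form, i.e. of the form `x ↦ Σᵢ ⟪ηᵢ, x ξᵢ⟫` with `Σ‖ξᵢ‖² < ∞`, `Σ‖ηᵢ‖² < ∞`. -/
def IsNormalForm {H₀ : Type*} [NormedAddCommGroup H₀] [InnerProductSpace ℂ H₀]
    (M : Set (H₀ →L[ℂ] H₀)) (φ : (H₀ →L[ℂ] H₀) → ℂ) : Prop :=
  ∃ ξ η : ℕ → H₀, (Summable fun i => ‖ξ i‖ ^ 2) ∧ (Summable fun i => ‖η i‖ ^ 2) ∧
    ∀ x ∈ M, HasSum (fun i => ⟪η i, x (ξ i)⟫) (φ x)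

/-- `T` is the operator on `ℓ²(Fin m; E)` implemented by the operator matrix `a`. -/
def ImplementsMat {E : Type*} [NormedAddCommGroup E] [InnerProductSpace ℂ E] {m : ℕ}
    (a : Matrix (Fin m) (Fin m) (E →L[ℂ] E))
    (T : (PiLp 2 fun _ : Fin m => E) →L[ℂ] PiLp 2 fun _ : Fin m => E) : Prop :=
  ∀ (ξ : PiLp 2 fun _ : Fin m => E) (i : Fin m),
    (WithLp.equiv 2 _) (T ξ) i = ∑ j, a i j ((WithLp.equiv 2 _) ξ j)


theorem exists_toLp {J K L : Type*} [NormedAddCommGroup L] [InnerProductSpace ℂ L]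
    [NormedAddCommGroup K] [InnerProductSpace ℂ K] (t : J → K →L[ℂ] L) (c : ℝ) (hc : 0 ≤ c)
    (h : ∀ (k : K) (s : Finset J), ∑ i ∈ s, ‖t i k‖ ^ 2 ≤ (c * ‖k‖) ^ 2) :
    ∃ W : K →L[ℂ] lp (fun _ : J => L) 2, (∀ k i, W k i = t i k) ∧ ∀ k, ‖W k‖ ≤ c * ‖k‖ := by
  have hm : ∀ k, Memℓp (fun i => t i k) 2 := fun k => by
    refine memℓp_gen' (C := (c * ‖k‖) ^ 2) fun s => ?_
    simpa using h k s
  let W0 : K →ₗ[ℂ] lp (fun _ : J => L) 2 :=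
    { toFun := fun k => ⟨fun i => t i k, hm k⟩
      map_add' := fun x y => by ext i; simp; rfl
      map_smul' := fun x y => by ext i; simp }
  have hb : ∀ k, ‖W0 k‖ ≤ c * ‖k‖ := fun k => by
    refine lp.norm_le_of_forall_sum_le (by simp) (by positivity) fun s => ?_
    simpa [W0] using h k s
  exact ⟨W0.mkContinuous c hb, fun k i => rfl, hb⟩

theorem lp_norm_sq {J L : Type*} [NormedAddCommGroup L] [InnerProductSpace ℂ L]
    (f : lp (fun _ : J => L) 2) : HasSum (fun i => ‖f i‖ ^ 2) (‖f‖ ^ 2) := by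
  simpa using lp.hasSum_norm (p := 2) (by simp) f

theorem exists_ampl (J : Type*) {L : Type*} [NormedAddCommGroup L] [InnerProductSpace ℂ L]
    (a : L →L[ℂ] L) :
    ∃ A : lp (fun _ : J => L) 2 →L[ℂ] lp (fun _ : J => L) 2, ∀ f i, A f i = a (f i) := by
  obtain ⟨W, hW, -⟩ := exists_toLp (fun i : J => a ∘L lp.evalCLM ℂ (fun _ : J => L) 2 i) ‖a‖
    (norm_nonneg _) (fun k s => by
      rw [mul_pow]
      calc _ ≤ ∑ i ∈ s, ‖a‖ ^ 2 * ‖k i‖ ^ 2 := by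
            refine Finset.sum_le_sum fun i _ => ?_
            rw [← mul_pow]
            exact pow_le_pow_left₀ (norm_nonneg _) (a.le_opNorm _) 2
        _ = ‖a‖ ^ 2 * ∑ i ∈ s, ‖k i‖ ^ 2 := by rw [Finset.mul_sum]
        _ ≤ _ := by
            gcongr
            exact sum_le_hasSum s (fun i _ => by positivity) (lp_norm_sq k))
  exact ⟨W, fun f i => hW f i⟩

noncomputable def ampl (J : Type*) {L : Type*} [NormedAddCommGroup L] [InnerProductSpace ℂ L]
    (a : L →L[ℂ] L) : lp (fun _ : J => L) 2 →L[ℂ] lp (fun _ : J => L) 2 :=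
  (exists_ampl J a).choose

theorem ampl_apply (J : Type*) {L : Type*} [NormedAddCommGroup L] [InnerProductSpace ℂ L]
    (a : L →L[ℂ] L) (f : lp (fun _ : J => L) 2) (i : J) : ampl J a f i = a (f i) :=
  (exists_ampl J a).choose_spec f i

set_option maxHeartbeats 1000000 in
theorem exists_W {K L : Type*} [NormedAddCommGroup L] [InnerProductSpace ℂ L] [CompleteSpace L]
    [NormedAddCommGroup K] [InnerProductSpace ℂ K] [CompleteSpace K]
    (N : Set (L →L[ℂ] L)) (hN : ∀ a ∈ N, star a ∈ N)
    (ρ : (L →L[ℂ] L) → (K →L[ℂ] K)) (hρ : ∀ a, ρ (star a) = star (ρ a)) :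
    ∃ (S : Set ((L →L[ℂ] K) × ℕ)) (W : K →L[ℂ] lp (fun _ : S => L) 2),
      (∀ i ∈ S, ∀ a ∈ N, i.1 ∘L a = ρ a ∘L i.1) ∧
      (∀ k i, W k i = i.1.1.adjoint k) ∧
      (∀ a ∈ N, ∀ k, W (ρ a k) = ampl S a (W k)) ∧
      (∀ a ∈ N, ∀ k, W.adjoint (W (ρ a k)) = ρ a (W.adjoint (W k))) ∧
      (∀ T : L →L[ℂ] K, (∀ a ∈ N, T ∘L a = ρ a ∘L T) → (W.adjoint ∘L W) ∘L T = T) := by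
  let P : Set (Set ((L →L[ℂ] K) × ℕ)) := {S | (∀ i ∈ S, ∀ a ∈ N, i.1 ∘L a = ρ a ∘L i.1) ∧
    ∀ (s : Finset ((L →L[ℂ] K) × ℕ)), (s : Set _) ⊆ S → ∀ k,
      ∑ i ∈ s, ‖i.1.adjoint k‖ ^ 2 ≤ ‖k‖ ^ 2}
  obtain ⟨S, hS⟩ : ∃ S, Maximal (· ∈ P) S := by
    refine zorn_subset P fun c hc hch => ?_
    refine ⟨⋃₀ c, ⟨?_, ?_⟩, fun s hs => Set.subset_sUnion_of_mem hs⟩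
    · rintro i ⟨s, hs, his⟩
      exact (hc hs).1 i his
    · intro s hs k
      rcases s.eq_empty_or_nonempty with rfl | hne
      · simp
      · have hcne : c.Nonempty := by
          obtain ⟨x, hx⟩ := hne
          obtain ⟨t, ht, -⟩ := hs hx
          exact ⟨t, ht⟩
        obtain ⟨t, ht, hst⟩ := DirectedOn.exists_mem_subset_of_finset_subset_biUnion
          (f := id) hcne (hch.directedOn) (s := s) (by simpa [Set.sUnion_eq_biUnion] using hs)
        exact (hc ht).2 s hst k
  obtain ⟨W, hW, hWn⟩ := exists_toLp (fun i : S => (i.1.1.adjoint : K →L[ℂ] L)) 1 zero_le_one (by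
    intro k s
    have := hS.prop.2 (s.map (Function.Embedding.subtype _)) (by simp) k
    simpa using this)
  simp only [one_mul] at hWn
  let D : K →L[ℂ] K := 1 - W.adjoint ∘L W
  have hadj : ∀ T : L →L[ℂ] K, (∀ a ∈ N, T ∘L a = ρ a ∘L T) → ∀ a ∈ N, ∀ k,
      T.adjoint (ρ a k) = a (T.adjoint k) := fun T hT a ha k => by
    have := congrArg ContinuousLinearMap.adjoint (hT _ (hN a ha))
    rw [ContinuousLinearMap.adjoint_comp, ContinuousLinearMap.adjoint_comp, hρ,
      ContinuousLinearMap.star_eq_adjoint, ContinuousLinearMap.star_eq_adjoint,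
      ContinuousLinearMap.adjoint_adjoint, ContinuousLinearMap.adjoint_adjoint] at this
    exact (DFunLike.congr_fun this k).symm
  have hWρ : ∀ a ∈ N, ∀ k, W (ρ a k) = ampl S a (W k) := fun a ha k => by
    ext i
    rw [ampl_apply, hW, hW, hadj _ (hS.prop.1 _ i.2) a ha]
  have hDρ : ∀ a ∈ N, D ∘L ρ a = ρ a ∘L D := fun a ha => by
    have : ∀ k l, ⟪W k, W (ρ a l)⟫ = ⟪W (ρ (star a) k), W l⟫ := fun k l => by
      rw [hWρ a ha, hWρ _ (hN a ha), lp.inner_eq_tsum, lp.inner_eq_tsum]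
      congr 1; ext i
      rw [ampl_apply, ampl_apply, ContinuousLinearMap.star_eq_adjoint,
        ContinuousLinearMap.adjoint_inner_left]
    ext l
    refine ext_inner_left ℂ fun k => ?_
    change ⟪k, ρ a l - W.adjoint (W (ρ a l))⟫ = ⟪k, ρ a (l - W.adjoint (W l))⟫
    rw [map_sub, inner_sub_right, inner_sub_right, ContinuousLinearMap.adjoint_inner_right, this,
      hρ, ContinuousLinearMap.star_eq_adjoint, ← ContinuousLinearMap.adjoint_inner_right W,
      ContinuousLinearMap.adjoint_inner_left (ρ a)]
  refine ⟨S, W, hS.prop.1, hW, hWρ, fun a ha k => ?_, fun T hT => ?_⟩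
  · have h1 : ρ a k - W.adjoint (W (ρ a k)) = ρ a (k - W.adjoint (W k)) :=
      DFunLike.congr_fun (hDρ a ha) k
    rw [map_sub] at h1
    exact sub_right_injective h1
  by_contra hne
  have hDk : ∀ k, ‖D k‖ ^ 2 ≤ ‖k‖ ^ 2 - ‖W k‖ ^ 2 := fun k => by
    have h1 : ‖W.adjoint (W k)‖ ≤ ‖W k‖ := by
      have h3 : ‖W.adjoint‖ ≤ 1 := by
        rw [LinearIsometryEquiv.norm_map]
        exact W.opNorm_le_bound zero_le_one (by simpa using hWn)
      calc _ ≤ ‖W.adjoint‖ * ‖W k‖ := W.adjoint.le_opNorm _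
        _ ≤ 1 * ‖W k‖ := by gcongr
        _ = _ := one_mul _
    have h2 : D k = k - W.adjoint (W k) := rfl
    rw [h2, @norm_sub_sq ℂ, ContinuousLinearMap.adjoint_inner_right, inner_self_eq_norm_sq]
    nlinarith [norm_nonneg (W.adjoint (W k)), norm_nonneg (W k)]
  have hDadj : D.adjoint = D := by
    refine ContinuousLinearMap.ext fun k => ext_inner_left ℂ fun l => ?_
    rw [ContinuousLinearMap.adjoint_inner_right]
    change ⟪l - W.adjoint (W l), k⟫ = ⟪l, k - W.adjoint (W k)⟫
    rw [inner_sub_left, inner_sub_right, ContinuousLinearMap.adjoint_inner_left,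
      ContinuousLinearMap.adjoint_inner_right]
  let c : ℝ := (‖T‖ + 1)⁻¹
  have hc : 0 < c := by positivity
  let T' : L →L[ℂ] K := (c : ℂ) • (D ∘L T)
  have hT'k : ∀ k, ‖T'.adjoint k‖ ^ 2 ≤ ‖k‖ ^ 2 - ‖W k‖ ^ 2 := fun k => by
    refine le_trans ?_ (hDk k)
    have h1 : T'.adjoint k = (c : ℂ) • T.adjoint (D k) := by
      refine ext_inner_left ℂ fun l => ?_
      rw [ContinuousLinearMap.adjoint_inner_right, inner_smul_right,
        ContinuousLinearMap.adjoint_inner_right]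
      change ⟪(c : ℂ) • D (T l), k⟫ = _
      rw [inner_smul_left, Complex.conj_ofReal, ← ContinuousLinearMap.adjoint_inner_right D, hDadj]
    have h2 : ‖T.adjoint (D k)‖ ≤ ‖T‖ * ‖D k‖ := by
      simpa using T.adjoint.le_opNorm (D k)
    refine pow_le_pow_left₀ (norm_nonneg _) ?_ 2
    rw [h1, norm_smul]
    simp only [Complex.norm_real, Real.norm_eq_abs, abs_of_pos hc]
    calc _ ≤ c * (‖T‖ * ‖D k‖) := by gcongr
      _ ≤ c * ((‖T‖ + 1) * ‖D k‖) := by gcongr; linarith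
      _ = ‖D k‖ := by rw [← mul_assoc, inv_mul_cancel₀ (by positivity), one_mul]
  have hT'i : ∀ a ∈ N, T' ∘L a = ρ a ∘L T' := fun a ha => by
    refine ContinuousLinearMap.ext fun l => ?_
    change (c : ℂ) • D (T (a l)) = ρ a ((c : ℂ) • D (T l))
    have e1 : T (a l) = ρ a (T l) := DFunLike.congr_fun (hT a ha) l
    have e2 : D (ρ a (T l)) = ρ a (D (T l)) := DFunLike.congr_fun (hDρ a ha) (T l)
    rw [map_smul, e1, e2]
  have hT'0 : T'.adjoint ≠ 0 := by
    intro h0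
    have h1 : T' = 0 := by simpa using h0
    apply hne
    refine ContinuousLinearMap.ext fun l => ?_
    have h2 : (c : ℂ) • (T l - W.adjoint (W (T l))) = 0 := DFunLike.congr_fun h1 l
    rcases smul_eq_zero.mp h2 with h | h
    · exact absurd (by exact_mod_cast h) hc.ne'
    · exact (sub_eq_zero.mp h).symm
  have hins : ∀ m : ℕ, (T', m) ∈ S := fun m => by
    by_contra hmem
    refine hmem (hS.le_of_ge (y := insert (T', m) S) ?_ (Set.subset_insert _ _) (Set.mem_insert _ _))
    refine ⟨?_, ?_⟩
    · rintro i (rfl | hi)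
      · exact hT'i
      · exact hS.prop.1 i hi
    · intro s hs k
      classical
      have h1 : ∑ i ∈ s.erase (T', m), ‖i.1.adjoint k‖ ^ 2 ≤ ‖W k‖ ^ 2 := by
        have hsub : ∀ i ∈ s.erase (T', m), i ∈ S := fun i hi => by
          rw [Finset.mem_erase] at hi
          exact (hs hi.2).resolve_left hi.1
        have := sum_le_hasSum ((s.erase (T', m)).subtype (· ∈ S)) (fun i _ => by positivity)
          (lp_norm_sq (W k))
        refine le_trans (le_of_eq ?_) this
        simp only [hW]
        rw [Finset.sum_subtype_of_mem (fun i : (L →L[ℂ] K) × ℕ => ‖i.1.adjoint k‖ ^ 2) hsub]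
      have h2 : ∑ i ∈ s, ‖i.1.adjoint k‖ ^ 2 ≤
          ∑ i ∈ s.erase (T', m), ‖i.1.adjoint k‖ ^ 2 + ‖T'.adjoint k‖ ^ 2 := by
        by_cases hm : (T', m) ∈ s
        · rw [Finset.sum_erase_add _ _ hm]
        · rw [Finset.erase_eq_of_notMem hm]; nlinarith [norm_nonneg (T'.adjoint k)]
      linarith [hT'k k]
  obtain ⟨k, hk⟩ : ∃ k, T'.adjoint k ≠ 0 := by
    by_contra! h
    exact hT'0 (ContinuousLinearMap.ext h)
  have hpos : 0 < ‖T'.adjoint k‖ ^ 2 := by positivity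
  obtain ⟨n, hn⟩ := Archimedean.arch (‖k‖ ^ 2 + 1) hpos
  have := hS.prop.2 ((Finset.range n).map ⟨fun m => (T', m), fun a b h => (Prod.mk.inj h).2⟩)
    (by intro x; simp only [Finset.coe_map, Set.mem_image]; rintro ⟨m, -, rfl⟩; exact hins m) k
  rw [Finset.sum_map] at this
  change ∑ x ∈ Finset.range n, ‖T'.adjoint k‖ ^ 2 ≤ _ at this
  rw [Finset.sum_const, Finset.card_range] at this
  linarith

theorem starProj_comm {K : Type*} [NormedAddCommGroup K] [InnerProductSpace ℂ K] [CompleteSpace K]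
    (Z : Submodule ℂ K) [Z.HasOrthogonalProjection] (A : K →L[ℂ] K) (h1 : ∀ z ∈ Z, A z ∈ Z)
    (h2 : ∀ z ∈ Z, A.adjoint z ∈ Z) (x : K) : Z.starProjection (A x) = A (Z.starProjection x) := by
  refine Submodule.eq_starProjection_of_mem_orthogonal (h1 _ (by simp)) ?_
  rw [← map_sub, Submodule.mem_orthogonal]
  intro u hu
  rw [← ContinuousLinearMap.adjoint_inner_left]
  exact (Submodule.mem_orthogonal _ _).1 (Submodule.sub_starProjection_mem_orthogonal x) _ (h2 u hu)

set_option maxHeartbeats 1000000 in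
theorem normal_part {K L : Type*} [NormedAddCommGroup L] [InnerProductSpace ℂ L] [CompleteSpace L]
    [NormedAddCommGroup K] [InnerProductSpace ℂ K] [CompleteSpace K]
    (N : VonNeumannAlgebra L)
    (ρ : (L →L[ℂ] L) → (K →L[ℂ] K)) (hρ : ∀ a, ρ (star a) = star (ρ a))
    (hmul : ∀ a b, ρ (a * b) = ρ a * ρ b) (hone : ρ 1 = 1) :
    ∃ (J : Set ((L →L[ℂ] K) × ℕ)) (W : K →L[ℂ] lp (fun _ : J => L) 2),
      (∀ a ∈ N, ∀ k, W (ρ a k) = ampl J a (W k)) ∧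
      (∀ T : L →L[ℂ] K, (∀ a ∈ N, T ∘L a = ρ a ∘L T) → (W.adjoint ∘L W) ∘L T = T) ∧
      ∀ ξ η ξ0 η0 : K, W.adjoint (W ξ0) = ξ0 → W.adjoint (W η0) = η0 →
        (∀ a ∈ N, ⟪η - η0, ρ a (ξ + ξ0)⟫ = 0) → ∀ a ∈ N, ⟪η, ρ a ξ⟫ = ⟪W η, W (ρ a ξ)⟫ := by
  obtain ⟨S, W, hSi, hW, hWρ, hQρ, hT⟩ := exists_W (N : Set (L →L[ℂ] L)) (fun a ha => star_mem ha) ρ hρ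
  refine ⟨S, W, hWρ, hT, fun ξ η ξ0 η0 hξ0 hη0 horth a ha => ?_⟩
  -- adjoint form
  have hT' : ∀ T : L →L[ℂ] K, (∀ a ∈ N, T ∘L a = ρ a ∘L T) →
      ∀ k, T.adjoint (W.adjoint (W k)) = T.adjoint k := fun T hTi k => by
    refine ext_inner_left ℂ fun l => ?_
    have h1 : W.adjoint (W (T l)) = T l := DFunLike.congr_fun (hT T hTi) l
    rw [ContinuousLinearMap.adjoint_inner_right, ContinuousLinearMap.adjoint_inner_right,
      ContinuousLinearMap.adjoint_inner_right, ← ContinuousLinearMap.adjoint_inner_left, h1]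
  have hQsa : ∀ k l, ⟪W.adjoint (W k), l⟫ = ⟪k, W.adjoint (W l)⟫ := fun k l => by
    rw [ContinuousLinearMap.adjoint_inner_right, ContinuousLinearMap.adjoint_inner_left]
  have hWQ : ∀ k, W (W.adjoint (W k)) = W k := fun k => by
    ext i
    rw [hW, hW, hT' _ (hSi _ i.2)]
  -- the cyclic projection
  let Z0 : Submodule ℂ K := Submodule.span ℂ (Set.range fun b : N => ρ b (ξ + ξ0))
  let Z : Submodule ℂ K := Z0.topologicalClosure
  have hZc : IsClosed (Z : Set K) := Submodule.isClosed_topologicalClosure _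
  have : CompleteSpace Z := hZc.completeSpace_coe
  have hinv : ∀ b ∈ N, ∀ z ∈ Z, ρ b z ∈ Z := fun b hb z hz => by
    have h0 : Z0 ≤ Z0.comap (ρ b : K →ₗ[ℂ] K) := by
      refine Submodule.span_le.mpr ?_
      rintro _ ⟨c, rfl⟩
      refine Submodule.subset_span ⟨⟨b * c, mul_mem hb c.2⟩, ?_⟩
      simp [hmul]
    have h1 : Set.MapsTo (ρ b) (Z0 : Set K) (Z0 : Set K) := fun x hx => h0 hx
    have := h1.closure (ρ b).continuous
    exact this hz
  let p : K →L[ℂ] K := Z.starProjection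
  have hpρ : ∀ b ∈ N, ∀ k, p (ρ b k) = ρ b (p k) := fun b hb k => by
    refine starProj_comm Z (ρ b) (hinv b hb) ?_ k
    rw [← ContinuousLinearMap.star_eq_adjoint, ← hρ]
    exact hinv _ (star_mem hb)
  have hpsa : ∀ k l, ⟪p k, l⟫ = ⟪k, p l⟫ := fun k l => Submodule.inner_starProjection_left_eq_right Z k l
  have hpx : p (ξ + ξ0) = ξ + ξ0 := by
    refine Submodule.starProjection_eq_self_iff.mpr ?_
    refine Submodule.le_topologicalClosure _ (Submodule.subset_span ⟨⟨1, one_mem N⟩, ?_⟩)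
    simp [hone]
  have hpy : p (η - η0) = 0 := by
    refine (Submodule.starProjection_apply_eq_zero_iff Z).mpr ?_
    have : Zᗮ = Z0ᗮ := Submodule.orthogonal_closure Z0
    rw [this, Submodule.mem_orthogonal']
    intro u hu
    have h0 : Z0 ≤ (innerSL ℂ (η - η0) : K →ₗ[ℂ] ℂ).ker := by
      refine Submodule.span_le.mpr ?_
      rintro _ ⟨c, rfl⟩
      exact horth c c.2
    exact h0 hu
  -- p commutes with Q
  have hWp : ∀ k, W (p (W.adjoint (W k))) = W (p k) := fun k => by
    ext i
    have hi : ∀ a ∈ N, (p ∘L i.1.1) ∘L a = ρ a ∘L (p ∘L i.1.1) := fun a ha => by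
      refine ContinuousLinearMap.ext fun l => ?_
      have e1 : i.1.1 (a l) = ρ a (i.1.1 l) := DFunLike.congr_fun (hSi _ i.2 a ha) l
      change p (i.1.1 (a l)) = ρ a (p (i.1.1 l))
      rw [e1, hpρ a ha]
    have hpa : ∀ k, (p ∘L i.1.1).adjoint k = i.1.1.adjoint (p k) := fun k => by
      refine ext_inner_left ℂ fun l => ?_
      rw [ContinuousLinearMap.adjoint_inner_right, ContinuousLinearMap.adjoint_inner_right]
      exact hpsa _ _
    have := hT' _ hi k
    rw [hpa, hpa] at this
    rw [hW, hW, this]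
  have hpQ : ∀ k, p (W.adjoint (W k)) = W.adjoint (W (p k)) := fun k => by
    have h1 : ∀ k, W.adjoint (W (p (W.adjoint (W k)))) = W.adjoint (W (p k)) := fun k => by rw [hWp]
    have h2 : ∀ k, W.adjoint (W (p (W.adjoint (W k)))) = p (W.adjoint (W k)) := fun k => by
      refine ext_inner_right ℂ fun l => ?_
      rw [hQsa, hpsa, hQsa, h1, hpsa, hQsa]
    rw [← h1, h2]
  let D : K → K := fun k => k - W.adjoint (W k)
  have hDp : ∀ k, p (D k) = D (p k) := fun k => by simp only [D, map_sub, hpQ]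
  have hDx : p (D ξ) = D ξ := by
    have h1 : D (ξ + ξ0) = D ξ := by simp only [D, map_add, hξ0]; abel
    rw [← h1, hDp, hpx]
  have hDy : p (D η) = 0 := by
    have h1 : D (η - η0) = D η := by simp only [D, map_sub, hη0]; abel
    rw [← h1, hDp, hpy]; simp [D]
  have key : ⟪D η, ρ a (D ξ)⟫ = 0 := by
    rw [← hDx, ← hpρ a ha, ← hpsa, hDy, inner_zero_left]
  have e : ⟪D η, ρ a (D ξ)⟫ = ⟪η, ρ a ξ⟫ - ⟪W η, W (ρ a ξ)⟫ := by
    simp only [D, map_sub, ← hQρ a ha, inner_sub_left, inner_sub_right,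
      ContinuousLinearMap.adjoint_inner_left, ContinuousLinearMap.adjoint_inner_right, hWQ]
    ring
  rw [e] at key
  exact sub_eq_zero.mp key

theorem ampl_mul (J : Type*) {L : Type*} [NormedAddCommGroup L] [InnerProductSpace ℂ L]
    (a b : L →L[ℂ] L) : ampl J (a * b) = ampl J a * ampl J b := by
  ext f i
  change ampl J (a * b) f i = ampl J a (ampl J b f) i
  simp [ampl_apply]

theorem ampl_one (J : Type*) {L : Type*} [NormedAddCommGroup L] [InnerProductSpace ℂ L] :
    ampl J (1 : L →L[ℂ] L) = 1 := by
  ext f i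
  simp [ampl_apply]

theorem ampl_inner (J : Type*) {L : Type*} [NormedAddCommGroup L] [InnerProductSpace ℂ L]
    [CompleteSpace L] (a : L →L[ℂ] L) (f g : lp (fun _ : J => L) 2) :
    ⟪f, ampl J (star a) g⟫ = ⟪ampl J a f, g⟫ := by
  rw [lp.inner_eq_tsum, lp.inner_eq_tsum]
  congr 1; ext i
  rw [ampl_apply, ampl_apply, ContinuousLinearMap.star_eq_adjoint,
    ContinuousLinearMap.adjoint_inner_right]

set_option maxHeartbeats 1000000 in
theorem exists_normal_dilation {K L H : Type*} [NormedAddCommGroup L] [InnerProductSpace ℂ L]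
    [CompleteSpace L] [NormedAddCommGroup K] [InnerProductSpace ℂ K] [CompleteSpace K]
    [NormedAddCommGroup H] [InnerProductSpace ℂ H]
    (N : VonNeumannAlgebra L)
    (ρ : (L →L[ℂ] L) → (K →L[ℂ] K)) (hρ : ∀ a, ρ (star a) = star (ρ a))
    (hmul : ∀ a b, ρ (a * b) = ρ a * ρ b) (hone : ρ 1 = 1)
    (V₁ V₂ : H →L[ℂ] K) (π : (L →L[ℂ] L) → (H →L[ℂ] H))
    (hπ : ∀ a ∈ N, ∀ u w, ⟪w, π a u⟫ = ⟪V₁ w, ρ a (V₂ u)⟫)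
    (hnormal : ∀ u w : H, IsNormalForm (N : Set (L →L[ℂ] L)) fun x => ⟪w, π x u⟫) :
    ∃ (J : Set ((L →L[ℂ] WithLp 2 (K × lp (fun _ : ℕ => L) 2)) × ℕ))
      (Y₁ Y₂ : H →L[ℂ] lp (fun _ : J => L) 2),
      ∀ a ∈ N, ∀ u w, ⟪w, π a u⟫ = ⟪Y₁ w, ampl J a (Y₂ u)⟫ := by
  let M := lp (fun _ : ℕ => L) 2
  let e := WithLp.prodContinuousLinearEquiv 2 ℂ K M
  let R : (L →L[ℂ] L) → (WithLp 2 (K × M) →L[ℂ] WithLp 2 (K × M)) := fun a =>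
    (e.symm : K × M →L[ℂ] WithLp 2 (K × M)) ∘L ((ρ a).prodMap (ampl ℕ a)) ∘L
      (e : WithLp 2 (K × M) →L[ℂ] K × M)
  have hR : ∀ a x, R a x = WithLp.toLp 2 (ρ a x.fst, ampl ℕ a x.snd) := fun a x => rfl
  let i1 : K →L[ℂ] WithLp 2 (K × M) :=
    (e.symm : K × M →L[ℂ] WithLp 2 (K × M)) ∘L ContinuousLinearMap.inl ℂ K M
  let i2 : M →L[ℂ] WithLp 2 (K × M) :=
    (e.symm : K × M →L[ℂ] WithLp 2 (K × M)) ∘L ContinuousLinearMap.inr ℂ K M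
  have hi1 : ∀ k, i1 k = WithLp.toLp 2 (k, 0) := fun k => rfl
  have hi2 : ∀ k, i2 k = WithLp.toLp 2 (0, k) := fun k => rfl
  obtain ⟨J, W, hWρ, hT, hmain⟩ := normal_part N R
    (fun a => by
      refine (ContinuousLinearMap.eq_adjoint_iff _ _).mpr ?_
      intro x y
      rw [hR, hR, WithLp.prod_inner_apply, WithLp.prod_inner_apply]
      change ⟪ρ (star a) x.fst, y.fst⟫ + ⟪ampl ℕ (star a) x.snd, y.snd⟫ =
        ⟪x.fst, ρ a y.fst⟫ + ⟪x.snd, ampl ℕ a y.snd⟫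
      rw [hρ, ContinuousLinearMap.star_eq_adjoint, ContinuousLinearMap.adjoint_inner_left,
        ← ampl_inner, star_star])
    (fun a b => by
      refine ContinuousLinearMap.ext fun x => ?_
      change R (a * b) x = R a (R b x)
      rw [hR, hR, hR, hmul, ampl_mul]; rfl)
    (by
      refine ContinuousLinearMap.ext fun x => ?_
      rw [hR, hone, ampl_one]; rfl)
  have hQ2 : ∀ m : M, W.adjoint (W (i2 m)) = i2 m := by
    classical
    intro m
    have hs := lp.hasSum_single (p := 2) (by simp) m
    have h1 : ∀ i : ℕ, W.adjoint (W (i2 (lp.single 2 i (m i)))) = i2 (lp.single 2 i (m i)) := by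
      intro i
      have := hT (i2 ∘L lp.singleContinuousLinearMap ℂ (fun _ : ℕ => L) 2 i) (fun a ha => by
        refine ContinuousLinearMap.ext fun l => ?_
        change i2 (lp.single 2 i (a l)) = R a (i2 (lp.single 2 i l))
        rw [hi2, hi2, hR]
        change _ = WithLp.toLp 2 (ρ a 0, ampl ℕ a (lp.single 2 i l))
        rw [map_zero]
        congr 2
        ext j
        rw [ampl_apply]
        by_cases hij : j = i
        · subst hij; simp
        · simp [lp.single_apply, Pi.single_apply, hij])
      exact DFunLike.congr_fun this (m i)
    have h2 := hs.mapL (W.adjoint ∘L W ∘L i2)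
    have h3 := hs.mapL i2
    refine h2.unique ?_
    have h4 : (fun i : ℕ => (W.adjoint ∘L W ∘L i2) (lp.single 2 i (m i))) =
        fun i : ℕ => i2 (lp.single 2 i (m i)) := funext h1
    rw [h4]
    exact h3
  refine ⟨J, W ∘L i1 ∘L V₁, W ∘L i1 ∘L V₂, fun a ha u w => ?_⟩
  obtain ⟨ξ, η, hξ, hη, hsum⟩ := hnormal u w
  have mk : ∀ ξ : ℕ → L, (Summable fun i => ‖ξ i‖ ^ 2) → ∃ f : M, ∀ i, f i = ξ i := fun ξ hξ =>
    ⟨⟨ξ, memℓp_gen (by simpa using hξ)⟩, fun i => rfl⟩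
  obtain ⟨ξ', hξ'⟩ := mk ξ hξ
  obtain ⟨η', hη'⟩ := mk η hη
  have hin : ∀ a ∈ N, ⟪η', ampl ℕ a ξ'⟫ = ⟪w, π a u⟫ := fun a ha => by
    refine (lp.hasSum_inner η' (ampl ℕ a ξ')).unique ?_
    simpa [ampl_apply, hξ', hη'] using hsum a ha
  have := hmain (i1 (V₂ u)) (i1 (V₁ w)) (i2 ξ') (i2 η') (hQ2 _) (hQ2 _) (fun a ha => by
    rw [hR, WithLp.prod_inner_apply]
    change ⟪V₁ w - 0, ρ a (V₂ u + 0)⟫ + ⟪0 - η', ampl ℕ a (0 + ξ')⟫ = 0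
    rw [sub_zero, add_zero, zero_sub, zero_add, inner_neg_left, hin a ha, hπ a ha]
    simp) a ha
  rw [hWρ a ha] at this
  rw [hπ a ha]
  refine Eq.trans ?_ this
  rw [hR, WithLp.prod_inner_apply]
  change _ = ⟪V₁ w, ρ a (V₂ u)⟫ + ⟪(0 : M), ampl ℕ a 0⟫
  simp

theorem normalForm_of_lp {J L : Type*} [NormedAddCommGroup L] [InnerProductSpace ℂ L]
    (f g : lp (fun _ : J => L) 2) :
    IsNormalForm (Set.univ : Set (L →L[ℂ] L)) fun x => ⟪g, ampl J x f⟫ := by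
  have hc : (Function.support fun i => ‖f i‖ ^ 2).Countable := (lp_norm_sq f).summable.countable_support
  set s := Function.support fun i => ‖f i‖ ^ 2 with hs
  have hs' : ∀ i, i ∉ s → f i = 0 := fun i hi => by simpa [hs] using hi
  have : Countable s := hc
  obtain ⟨e, he⟩ := exists_injective_nat s
  have key : ∀ h : lp (fun _ : J => L) 2,
      Summable fun n => ‖Function.extend e (fun i : s => h i) 0 n‖ ^ 2 := fun h => by
    have h1 : Summable fun i : s => ‖h i‖ ^ 2 := (lp_norm_sq h).summable.subtype s
    refine (he.summable_iff ?_).mp ?_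
    · intro x hx
      rw [Function.extend_apply' _ _ _ (by simpa using hx)]; simp
    · convert h1 using 2 with i
      simp [he.extend_apply]
  refine ⟨Function.extend e (fun i : s => f i) 0, Function.extend e (fun i : s => g i) 0,
    key f, key g, fun x _ => ?_⟩
  have h1 := lp.hasSum_inner (𝕜 := ℂ) g (ampl J x f)
  refine (he.hasSum_iff ?_).mp ?_
  · intro n hn
    rw [Function.extend_apply' _ _ _ (by simpa using hn)]; simp
  · have h2 := (hasSum_subtype_iff_of_support_subset (s := s) (fun i hi => by
      by_contra hns
      apply hi
      change ⟪g i, ampl J x f i⟫ = 0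
      rw [ampl_apply, hs' i hns, map_zero, inner_zero_right])).mpr h1
    have h3 : ((fun n => ⟪Function.extend e (fun i : s => g i) 0 n,
        x (Function.extend e (fun i : s => f i) 0 n)⟫) ∘ e) =
        ((fun i => ⟪g i, ampl J x f i⟫) ∘ ((↑) : s → J)) := by
      funext i
      change ⟪Function.extend e (fun i : s => g i) 0 (e i),
        x (Function.extend e (fun i : s => f i) 0 (e i))⟫ = ⟪g i, ampl J x f i⟫
      rw [he.extend_apply, he.extend_apply, ampl_apply]
    rw [h3]
    exact h2

theorem piLp_norm_sq {E : Type*} [NormedAddCommGroup E] [InnerProductSpace ℂ E] {n : ℕ}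
    (x : PiLp 2 fun _ : Fin n => E) : ‖x‖ ^ 2 = ∑ i, ‖x i‖ ^ 2 := PiLp.norm_sq_eq_of_L2 _ x

set_option maxHeartbeats 1000000 in
theorem ext_of_dilation {J L H : Type*} [NormedAddCommGroup L] [InnerProductSpace ℂ L]
    [CompleteSpace L] [NormedAddCommGroup H] [InnerProductSpace ℂ H] [CompleteSpace H]
    (Y₁ Y₂ : H →L[ℂ] lp (fun _ : J => L) 2) :
    ∃ (πt : (L →L[ℂ] L) →ₗ[ℂ] (H →L[ℂ] H)) (C' : ℝ),
      (∀ (n : ℕ) (a : Matrix (Fin n) (Fin n) (L →L[ℂ] L)),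
        ∀ S T, ImplementsMat a S → ImplementsMat (Matrix.of fun i j => πt (a i j)) T →
          ‖T‖ ≤ C' * ‖S‖) ∧
      (∀ u w : H, IsNormalForm (Set.univ : Set (L →L[ℂ] L)) fun x => ⟪w, πt x u⟫) ∧
      (∀ x u w, ⟪w, πt x u⟫ = ⟪Y₁ w, ampl J x (Y₂ u)⟫) := by
  let πt : (L →L[ℂ] L) →ₗ[ℂ] (H →L[ℂ] H) :=
    { toFun := fun x => Y₁.adjoint ∘L ampl J x ∘L Y₂
      map_add' := fun x y => by
        have : ampl J (x + y) = ampl J x + ampl J y := by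
          ext f i
          change ampl J (x + y) f i = ampl J x f i + ampl J y f i
          simp [ampl_apply]
        ext u; simp [this]
      map_smul' := fun c x => by
        have : ampl J (c • x) = c • ampl J x := by
          ext f i
          change ampl J (c • x) f i = c • ampl J x f i
          simp [ampl_apply]
        ext u; simp [this] }
  have hπ : ∀ x u, πt x u = Y₁.adjoint (ampl J x (Y₂ u)) := fun x u => rfl
  have hin : ∀ x u w, ⟪w, πt x u⟫ = ⟪Y₁ w, ampl J x (Y₂ u)⟫ := fun x u w => by
    rw [hπ, ContinuousLinearMap.adjoint_inner_right]
  refine ⟨πt, ‖Y₁‖ * ‖Y₂‖, fun n a S T hS hT => ?_, fun u w => ?_, hin⟩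
  · refine T.opNorm_le_bound (by positivity) fun u => ?_
    let z : Fin n → lp (fun _ : J => L) 2 := fun i => ∑ j, ampl J (a i j) (Y₂ (u j))
    have hTu : ∀ i, T u i = Y₁.adjoint (z i) := fun i => by
      have h1 : T u i = ∑ j, πt (a i j) (u j) := hT u i
      rw [h1, map_sum]; rfl
    let x : J → PiLp 2 fun _ : Fin n => L := fun k => WithLp.toLp 2 fun j => Y₂ (u j) k
    have hzk : ∀ i k, z i k = S (x k) i := fun i k => by
      have h1 : S (x k) i = ∑ j, a i j (x k j) := hS (x k) i
      rw [h1]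
      have h2 : z i k = ∑ j, ampl J (a i j) (Y₂ (u j)) k := by
        simp only [z]
        rw [lp.coeFn_sum, Finset.sum_apply]
      rw [h2]
      simp [ampl_apply, x]
    have h1 : HasSum (fun k => ‖S (x k)‖ ^ 2) (∑ i, ‖z i‖ ^ 2) := by
      simp only [piLp_norm_sq, ← hzk]
      exact hasSum_sum fun i _ => lp_norm_sq (z i)
    have h2 : HasSum (fun k => ‖S‖ ^ 2 * ‖x k‖ ^ 2) (‖S‖ ^ 2 * ∑ j, ‖Y₂ (u j)‖ ^ 2) := by
      refine HasSum.mul_left _ ?_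
      simp only [piLp_norm_sq]
      exact hasSum_sum fun i _ => lp_norm_sq (Y₂ (u i))
    have h3 : ∑ i, ‖z i‖ ^ 2 ≤ ‖S‖ ^ 2 * ∑ j, ‖Y₂ (u j)‖ ^ 2 := by
      refine hasSum_le (fun k => ?_) h1 h2
      rw [← mul_pow]
      exact pow_le_pow_left₀ (norm_nonneg _) (S.le_opNorm _) 2
    have h4 : ∑ j, ‖Y₂ (u j)‖ ^ 2 ≤ ‖Y₂‖ ^ 2 * ‖u‖ ^ 2 := by
      rw [piLp_norm_sq u, Finset.mul_sum]
      refine Finset.sum_le_sum fun j _ => ?_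
      rw [← mul_pow]
      exact pow_le_pow_left₀ (norm_nonneg _) (Y₂.le_opNorm _) 2
    have h5 : ‖T u‖ ^ 2 ≤ ‖Y₁‖ ^ 2 * ∑ i, ‖z i‖ ^ 2 := by
      rw [piLp_norm_sq (T u), Finset.mul_sum]
      refine Finset.sum_le_sum fun j _ => ?_
      rw [← mul_pow, hTu]
      refine pow_le_pow_left₀ (norm_nonneg _) ?_ 2
      simpa using Y₁.adjoint.le_opNorm (z j)
    refine le_of_sq_le_sq ?_ (by positivity)
    calc ‖T u‖ ^ 2 ≤ ‖Y₁‖ ^ 2 * (‖S‖ ^ 2 * (‖Y₂‖ ^ 2 * ‖u‖ ^ 2)) := by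
          refine h5.trans ?_
          gcongr
          refine h3.trans ?_
          gcongr
      _ = _ := by ring
  · simp only [hin]
    exact normalForm_of_lp _ _

universe uX uA

set_option maxHeartbeats 1000000 in
theorem gns_general {X : Type uX} [AddCommGroup X] [Module ℂ X] (c : PreInnerProductSpace.Core ℂ X)
    {A : Type uA} [Ring A] [StarRing A] (act : A → X →ₗ[ℂ] X)
    (hbd : ∀ a, ∃ C : ℝ, 0 ≤ C ∧ ∀ x, (c.inner (act a x) (act a x)).re ≤ C ^ 2 * (c.inner x x).re)
    (hadj : ∀ a x y, c.inner (act (star a) x) y = c.inner x (act a y))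
    (hmul : ∀ a b x, act (a * b) x = act a (act b x)) (hone : ∀ x, act 1 x = x) :
    ∃ (K : Type uX) (_ : NormedAddCommGroup K) (_ : InnerProductSpace ℂ K) (_ : CompleteSpace K)
      (ρ : A → K →L[ℂ] K) (ι : X →ₗ[ℂ] K), (∀ x y, ⟪ι x, ι y⟫ = c.inner x y) ∧
      (∀ a x, ρ a (ι x) = ι (act a x)) ∧ (∀ a, ρ (star a) = star (ρ a)) ∧
      (∀ a b, ρ (a * b) = ρ a * ρ b) ∧ ρ 1 = 1 := by
  letI i1 : SeminormedAddCommGroup X := InnerProductSpace.Core.toSeminormedAddCommGroup (c := c)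
  letI i2 : InnerProductSpace ℂ X := InnerProductSpace.ofCore c
  have hin : ∀ x y : X, ⟪x, y⟫ = c.inner x y := fun x y => rfl
  have hns : ∀ x : X, ‖x‖ ^ 2 = (c.inner x x).re := fun x => by
    rw [← hin]; exact (inner_self_eq_norm_sq (𝕜 := ℂ) x).symm
  let B : A → X →L[ℂ] X := fun a => (act a).mkContinuous (hbd a).choose (fun x => by
    obtain ⟨h1, h2⟩ := (hbd a).choose_spec
    refine le_of_sq_le_sq ?_ (by positivity)
    rw [mul_pow, hns, hns]
    exact h2 x)
  have hB : ∀ a x, B a x = act a x := fun a x => rfl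
  let ι : X →L[ℂ] UniformSpace.Completion X := UniformSpace.Completion.toComplL
  refine ⟨UniformSpace.Completion X, inferInstance, inferInstance, inferInstance,
    fun a => (B a).completion, ι.toLinearMap, fun x y => ?_, fun a x => ?_, fun a => ?_,
    fun a b => ?_, ?_⟩
  · exact UniformSpace.Completion.inner_coe x y
  · exact ContinuousLinearMap.completion_apply_coe (B a) x
  · refine (ContinuousLinearMap.eq_adjoint_iff _ _).mpr fun x y => ?_
    induction x, y using UniformSpace.Completion.induction_on₂ with
    | hp => apply isClosed_eq <;> fun_prop
    | ih x y =>
      rw [ContinuousLinearMap.completion_apply_coe, ContinuousLinearMap.completion_apply_coe,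
        UniformSpace.Completion.inner_coe, UniformSpace.Completion.inner_coe]
      exact hadj a x y
  · refine ContinuousLinearMap.ext fun x => ?_
    change (B (a * b)).completion x = (B a).completion ((B b).completion x)
    induction x using UniformSpace.Completion.induction_on with
    | hp => apply isClosed_eq <;> fun_prop
    | ih x =>
      rw [ContinuousLinearMap.completion_apply_coe, ContinuousLinearMap.completion_apply_coe,
        ContinuousLinearMap.completion_apply_coe, hB, hB, hB, hmul]
  · refine ContinuousLinearMap.ext fun x => ?_
    change (B 1).completion x = x
    induction x using UniformSpace.Completion.induction_on with
    | hp => apply isClosed_eq <;> fun_prop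
    | ih x => rw [ContinuousLinearMap.completion_apply_coe, hB, hone]

universe uL uP

set_option maxHeartbeats 1000000 in
theorem stinespring {L : Type uL} {P : Type uP} [NormedAddCommGroup L] [InnerProductSpace ℂ L]
    [CompleteSpace L] (G : P → P → (L →L[ℂ] L) →ₗ[ℂ] ℂ)
    (herm : ∀ p q a, G q p (star a) = star (G p q a))
    (pos : ∀ m : L →L[ℂ] L, (∀ l, 0 ≤ (⟪l, m l⟫).re) → ∀ x : P →₀ (L →L[ℂ] L),
      0 ≤ (x.sum fun p xp => x.sum fun q xq => G p q (star xp * m * xq)).re) :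
    ∃ (K : Type (max uL uP)) (_ : NormedAddCommGroup K) (_ : InnerProductSpace ℂ K)
      (_ : CompleteSpace K) (ρ : (L →L[ℂ] L) → K →L[ℂ] K) (v : P → K),
      (∀ p q a, ⟪v p, ρ a (v q)⟫ = G p q a) ∧ (∀ a, ρ (star a) = star (ρ a)) ∧
      (∀ a b, ρ (a * b) = ρ a * ρ b) ∧ ρ 1 = 1 := by
  classical
  -- the sesquilinear form
  let F : (L →L[ℂ] L) → (P →₀ (L →L[ℂ] L)) → (P →₀ (L →L[ℂ] L)) → ℂ := fun m x y =>
    x.sum fun p xp => y.sum fun q yq => G p q (star xp * m * yq)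
  have hF : ∀ m x y, F m x y = x.sum fun p xp => y.sum fun q yq => G p q (star xp * m * yq) :=
    fun m x y => rfl
  let c : PreInnerProductSpace.Core ℂ (P →₀ (L →L[ℂ] L)) :=
    { inner := F 1
      conj_inner_symm := fun x y => by
        simp only [F, Finsupp.sum, map_sum, mul_one]
        rw [Finset.sum_comm]
        refine Finset.sum_congr rfl fun p _ => Finset.sum_congr rfl fun q _ => ?_
        have := herm q p (star (y q) * x p)
        rw [star_mul, star_star] at this
        rw [this]; simp
      re_inner_nonneg := fun x => pos 1 (fun l => by
        have := inner_self_nonneg (𝕜 := ℂ) (x := l)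
        simpa using this) x
      add_left := fun x y z => by
        simp only [F]
        refine Finsupp.sum_add_index' (fun p => by simp) (fun p a b => ?_)
        simp [Finsupp.sum, add_mul, Finset.sum_add_distrib]
      smul_left := fun x y r => by
        simp only [F]
        rw [Finsupp.sum_smul_index' (fun p => by simp)]
        simp [Finsupp.sum, Finset.mul_sum] }
  have hc : ∀ x y, c.inner x y = F 1 x y := fun x y => rfl
  let act : (L →L[ℂ] L) → (P →₀ (L →L[ℂ] L)) →ₗ[ℂ] (P →₀ (L →L[ℂ] L)) := fun a =>
    Finsupp.mapRange.linearMap (LinearMap.mulLeft ℂ a)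
  have hact : ∀ a x p, act a x p = a * x p := fun a x p => rfl
  have hFact : ∀ a m b x y, F m (act a x) (act b y) = F (star a * m * b) x y := fun a m b x y => by
    simp only [F, act, Finsupp.mapRange.linearMap_apply]
    rw [Finsupp.sum_mapRange_index (fun p => by simp)]
    refine Finsupp.sum_congr fun p _ => ?_
    rw [Finsupp.sum_mapRange_index (fun p => by simp)]
    refine Finsupp.sum_congr fun q _ => ?_
    simp [mul_assoc]
  have hone : ∀ x, act 1 x = x := fun x => by ext p : 1; simp [hact]
  obtain ⟨K, j1, j2, j3, ρ, ι, hι, hρι, hs, hm, ho⟩ := gns_general c act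
    (fun a => ⟨‖a‖, norm_nonneg _, fun x => by
      rw [hc, hc, hFact]
      have hp := pos (((‖a‖ ^ 2 : ℝ) : ℂ) • 1 - star a * 1 * a) (fun l => by
        have h1 : ‖a l‖ ^ 2 ≤ ‖a‖ ^ 2 * ‖l‖ ^ 2 := by
          rw [← mul_pow]
          exact pow_le_pow_left₀ (norm_nonneg _) (a.le_opNorm _) 2
        have h2 : ((((‖a‖ ^ 2 : ℝ) : ℂ) • 1 - star a * 1 * a : L →L[ℂ] L)) l =
          ((‖a‖ ^ 2 : ℝ) : ℂ) • l - a.adjoint (a l) := by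
          rw [mul_one, ContinuousLinearMap.star_eq_adjoint]; rfl
        rw [h2, inner_sub_right, inner_smul_right, ContinuousLinearMap.adjoint_inner_right,
          inner_self_eq_norm_sq_to_K, inner_self_eq_norm_sq_to_K]
        have h5 : ((‖a‖ ^ 2 : ℝ) : ℂ) * ((‖l‖ : ℝ) : ℂ) ^ 2 - ((‖a l‖ : ℝ) : ℂ) ^ 2 =
            ((‖a‖ ^ 2 * ‖l‖ ^ 2 - ‖a l‖ ^ 2 : ℝ) : ℂ) := by push_cast; ring
        have h6 : (((‖a‖ ^ 2 : ℝ) : ℂ) * ((‖l‖ : ℝ) : ℂ) ^ 2 - ((‖a l‖ : ℝ) : ℂ) ^ 2).re =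
            ‖a‖ ^ 2 * ‖l‖ ^ 2 - ‖a l‖ ^ 2 := by rw [h5, Complex.ofReal_re]
        exact (sub_nonneg.mpr h1).trans_eq h6.symm) x
      have h3 : (x.sum fun p xp => x.sum fun q xq => G p q (star xp *
          (((‖a‖ ^ 2 : ℝ) : ℂ) • 1 - star a * 1 * a) * xq)) =
          ((‖a‖ ^ 2 : ℝ) : ℂ) * F 1 x x - F (star a * 1 * a) x x := by
        simp only [F, Finsupp.sum, Finset.mul_sum, ← Finset.sum_sub_distrib]
        refine Finset.sum_congr rfl fun p _ => Finset.sum_congr rfl fun q _ => ?_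
        rw [mul_sub, sub_mul, map_sub, mul_smul_comm, smul_mul_assoc, map_smul, smul_eq_mul]
      rw [h3, Complex.sub_re, Complex.re_ofReal_mul] at hp
      linarith⟩)
    (fun a x y => by
      rw [hc, hc]
      have e1 := hFact (star a) 1 1 x y
      have e2 := hFact 1 1 a x y
      rw [hone] at e1 e2
      rw [e1, e2]
      simp)
    (fun a b x => by ext p : 1; simp [hact, mul_assoc]) hone
  refine ⟨K, j1, j2, j3, ρ, fun p => ι (Finsupp.single p 1), fun p q a => ?_, hs, hm, ho⟩
  rw [hρι, hι, hc, hF, Finsupp.sum_single_index (by simp)]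
  simp only [act, Finsupp.mapRange.linearMap_apply, Finsupp.mapRange_single]
  rw [Finsupp.sum_single_index (by simp)]
  simp

theorem exists_implements {E : Type*} [NormedAddCommGroup E] [InnerProductSpace ℂ E] {m : ℕ}
    (a : Matrix (Fin m) (Fin m) (E →L[ℂ] E)) :
    ∃ T : (PiLp 2 fun _ : Fin m => E) →L[ℂ] PiLp 2 fun _ : Fin m => E, ImplementsMat a T := by
  let e := PiLp.continuousLinearEquiv 2 ℂ (fun _ : Fin m => E)
  let T₀ : (Fin m → E) →L[ℂ] (Fin m → E) :=
    ContinuousLinearMap.pi fun i => ∑ j, (a i j) ∘L (ContinuousLinearMap.proj j)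
  refine ⟨e.symm.toContinuousLinearMap ∘L T₀ ∘L e.toContinuousLinearMap, fun ξ i => ?_⟩
  change T₀ (e ξ) i = ∑ j, a i j (e ξ j)
  simp [T₀]

theorem piLp_inner_implements {E : Type*} [NormedAddCommGroup E] [InnerProductSpace ℂ E] {m : ℕ}
    {a : Matrix (Fin m) (Fin m) (E →L[ℂ] E)}
    {T : (PiLp 2 fun _ : Fin m => E) →L[ℂ] PiLp 2 fun _ : Fin m => E} (h : ImplementsMat a T)
    (x y : PiLp 2 fun _ : Fin m => E) : ⟪x, T y⟫ = ∑ i, ∑ j, ⟪x i, a i j (y j)⟫ := by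
  rw [PiLp.inner_apply]
  refine Finset.sum_congr rfl fun i _ => ?_
  have h1 : T y i = ∑ j, a i j (y j) := h y i
  rw [h1, inner_sum]

theorem change_var {E : Type*} [NormedAddCommGroup E] [InnerProductSpace ℂ E] {m : ℕ}
    (D₁ D₂ : Matrix (Fin m) (Fin m) ℂ) (a : Matrix (Fin m) (Fin m) (E →L[ℂ] E))
    (x y : Fin m → E) :
    ∑ k, ∑ l, ⟪x k, (∑ i, ∑ j, (star (D₁ i k) * D₂ j l) • a i j) (y l)⟫ =
      ∑ i, ∑ j, ⟪∑ k, D₁ i k • x k, a i j (∑ l, D₂ j l • y l)⟫ := by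
  simp only [map_sum, map_smul, sum_inner, inner_sum, inner_smul_left, inner_smul_right,
    sum_apply, smul_apply]
  have h1 : ∀ f : Fin m → Fin m → Fin m → Fin m → ℂ,
      ∑ k, ∑ l, ∑ i, ∑ j, f k l i j = ∑ i, ∑ j, ∑ l, ∑ k, f k l i j := fun f => by
    calc _ = ∑ k, ∑ i, ∑ l, ∑ j, f k l i j :=
          Finset.sum_congr rfl fun k _ => Finset.sum_comm
      _ = ∑ i, ∑ k, ∑ l, ∑ j, f k l i j := Finset.sum_comm
      _ = ∑ i, ∑ k, ∑ j, ∑ l, f k l i j :=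
          Finset.sum_congr rfl fun k _ => Finset.sum_congr rfl fun k _ => Finset.sum_comm
      _ = ∑ i, ∑ j, ∑ k, ∑ l, f k l i j := Finset.sum_congr rfl fun k _ => Finset.sum_comm
      _ = _ := Finset.sum_congr rfl fun k _ => Finset.sum_congr rfl fun k _ => Finset.sum_comm
  rw [h1]
  refine Finset.sum_congr rfl fun i _ => Finset.sum_congr rfl fun j _ => ?_
  refine Finset.sum_congr rfl fun l _ => ?_
  rw [Finset.mul_sum]
  refine Finset.sum_congr rfl fun k _ => ?_
  simp only [RCLike.star_def]
  ring

theorem mat_cancel {E : Type*} [AddCommGroup E] [Module ℂ E] {m : ℕ}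
    (D B : Matrix (Fin m) (Fin m) ℂ) (h : D * B = 1) (x : Fin m → E) (i : Fin m) :
    ∑ k, D i k • ∑ j, B k j • x j = x i := by
  simp only [Finset.smul_sum, smul_smul]
  rw [Finset.sum_comm]
  simp only [← Finset.sum_smul]
  have h1 : ∀ j, ∑ k, D i k * B k j = (1 : Matrix (Fin m) (Fin m) ℂ) i j := fun j => by
    rw [← h, Matrix.mul_apply]
  simp [h1, Matrix.one_apply]

theorem core_ineq {L H : Type*}
    [NormedAddCommGroup L] [InnerProductSpace ℂ L] [CompleteSpace L]
    [NormedAddCommGroup H] [InnerProductSpace ℂ H] [CompleteSpace H]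
    (N : VonNeumannAlgebra L)
    (π : (L →L[ℂ] L) →ₗ[ℂ] (H →L[ℂ] H))
    (C : ℝ) (hC : 0 ≤ C)
    (hcb : ∀ (n : ℕ) (a : Matrix (Fin n) (Fin n) (L →L[ℂ] L)), (∀ i j, a i j ∈ N) →
      ∀ S T, ImplementsMat a S → ImplementsMat (Matrix.of fun i j => π (a i j)) T →
        ‖T‖ ≤ C * ‖S‖)
    {n : ℕ} (B₁ B₂ D₁ D₂ : Matrix (Fin n) (Fin n) ℂ) (h₁ : D₁ * B₁ = 1) (h₂ : D₂ * B₂ = 1)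
    (a : Matrix (Fin n) (Fin n) (L →L[ℂ] L)) (ha : ∀ i j, a i j ∈ N)
    (hpos : ∀ ξ η : Fin n → L, 0 ≤ ∑ i, ‖∑ j, B₁ i j • ξ j‖ ^ 2 + ∑ i, ‖∑ j, B₂ i j • η j‖ ^ 2 +
      (∑ i, ∑ j, ⟪ξ i, a i j (η j)⟫).re) (u v : Fin n → H) :
    0 ≤ C * (∑ i, ‖∑ j, B₁ i j • u j‖ ^ 2 + ∑ i, ‖∑ j, B₂ i j • v j‖ ^ 2) +
      (∑ i, ∑ j, ⟪u i, π (a i j) (v j)⟫).re := by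
  have h₁' : B₁ * D₁ = 1 := mul_eq_one_comm.mp h₁
  have h₂' : B₂ * D₂ = 1 := mul_eq_one_comm.mp h₂
  let c : Matrix (Fin n) (Fin n) (L →L[ℂ] L) := Matrix.of fun k l =>
    ∑ i, ∑ j, (star (D₁ i k) * D₂ j l) • a i j
  have hcN : ∀ i j, c i j ∈ N := fun i j => by
    change (∑ i', ∑ j', (star (D₁ i' i) * D₂ j' j) • a i' j') ∈ N.toStarSubalgebra
    exact sum_mem fun k _ => sum_mem fun l _ => N.toStarSubalgebra.smul_mem (ha _ _) _
  obtain ⟨S, hS⟩ := exists_implements c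
  obtain ⟨T, hT⟩ := exists_implements (Matrix.of fun i j => π (c i j))
  have hSn : ‖S‖ ≤ 2 := by
    refine S.opNorm_le_bound (by norm_num) fun y => ?_
    have h := fun x : PiLp 2 fun _ : Fin n => L => hpos (fun i => ∑ k, D₁ i k • x k)
      (fun i => ∑ k, D₂ i k • y k)
    simp only [mat_cancel B₁ D₁ h₁', mat_cancel B₂ D₂ h₂', ← change_var, ← piLp_norm_sq] at h
    have h' := fun x => (h x).trans_eq (congrArg (fun z => ‖x‖ ^ 2 + ‖y‖ ^ 2 + Complex.re z)
      (piLp_inner_implements hS x y).symm)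
    have h3 := h' (((-1/2 : ℝ) : ℂ) • S y)
    rw [inner_smul_left, Complex.conj_ofReal, Complex.re_ofReal_mul, norm_smul, Complex.norm_real]
      at h3
    have h4 : (⟪S y, S y⟫).re = ‖S y‖ ^ 2 := inner_self_eq_norm_sq (𝕜 := ℂ) (S y)
    rw [h4] at h3
    norm_num at h3
    refine le_of_sq_le_sq ?_ (by positivity)
    nlinarith
  have hTn : ‖T‖ ≤ C * 2 := (hcb n c hcN S T hS hT).trans (by gcongr)
  let x : PiLp 2 fun _ : Fin n => H := WithLp.toLp 2 fun i => ∑ j, B₁ i j • u j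
  let y : PiLp 2 fun _ : Fin n => H := WithLp.toLp 2 fun i => ∑ j, B₂ i j • v j
  have e1 : ⟪x, T y⟫ = ∑ i, ∑ j, ⟪u i, π (a i j) (v j)⟫ := by
    rw [piLp_inner_implements hT]
    have := change_var D₁ D₂ (Matrix.of fun i j => π (a i j)) x y
    simp only [x, y, mat_cancel D₁ B₁ h₁, mat_cancel D₂ B₂ h₂, Matrix.of_apply] at this
    rw [← this]
    simp only [Matrix.of_apply, c, map_sum, map_smul, x, y]
  have e2 : ‖x‖ ^ 2 = ∑ i, ‖∑ j, B₁ i j • u j‖ ^ 2 := piLp_norm_sq x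
  have e3 : ‖y‖ ^ 2 = ∑ i, ‖∑ j, B₂ i j • v j‖ ^ 2 := piLp_norm_sq y
  rw [← e1, ← e2, ← e3]
  have h5 : |(⟪x, T y⟫).re| ≤ ‖x‖ * (C * 2 * ‖y‖) := by
    refine (Complex.abs_re_le_norm _).trans ((norm_inner_le_norm _ _).trans ?_)
    gcongr
    exact (T.le_opNorm y).trans (by gcongr)
  have h6 := neg_le_of_abs_le h5
  nlinarith [mul_nonneg hC (sq_nonneg (‖x‖ - ‖y‖))]

open scoped MatrixOrder ComplexOrder in
theorem qform_factor {n : ℕ} (M : Matrix (Fin n) (Fin n) ℂ)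
    (hM : ∀ z : Fin n → ℂ, 0 ≤ (∑ i, ∑ j, M i j * (star (z i) * z j)).re) (ε : ℝ) (hε : 0 < ε) :
    ∃ B D : Matrix (Fin n) (Fin n) ℂ, D * B = 1 ∧
      B.conjTranspose * B = (2 : ℂ)⁻¹ • (M + M.conjTranspose) + (ε : ℂ) • 1 := by
  set Λ : Matrix (Fin n) (Fin n) ℂ := (2 : ℂ)⁻¹ • (M + M.conjTranspose) + (ε : ℂ) • 1 with hΛ
  have hh : Λ.IsHermitian := by
    rw [Matrix.IsHermitian, hΛ]
    simp [Matrix.conjTranspose_add, Matrix.conjTranspose_smul, add_comm]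
  have hq : ∀ z : Fin n → ℂ, star z ⬝ᵥ (Λ.mulVec z) =
      (((∑ i, ∑ j, M i j * (star (z i) * z j)).re + ε * ∑ i, ‖z i‖ ^ 2 : ℝ) : ℂ) := fun z => by
    have e1 : star z ⬝ᵥ (M.mulVec z) = ∑ i, ∑ j, M i j * (star (z i) * z j) := by
      simp only [dotProduct, Matrix.mulVec, Finset.mul_sum, Pi.star_apply]
      exact Finset.sum_congr rfl fun i _ => Finset.sum_congr rfl fun j _ => by ring
    have e2 : star z ⬝ᵥ (M.conjTranspose.mulVec z) =
        star (∑ i, ∑ j, M i j * (star (z i) * z j)) := by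
      simp only [dotProduct, Matrix.mulVec, Finset.mul_sum, Pi.star_apply, star_sum]
      rw [Finset.sum_comm]
      exact Finset.sum_congr rfl fun i _ => Finset.sum_congr rfl fun j _ => by
        simp only [Matrix.conjTranspose_apply, star_mul, star_star]; ring
    have e3 : star z ⬝ᵥ z = ((∑ i, ‖z i‖ ^ 2 : ℝ) : ℂ) := by
      simp only [dotProduct, Pi.star_apply]
      push_cast
      exact Finset.sum_congr rfl fun i _ => by
        rw [mul_comm]; exact Complex.mul_conj' (z i)
    rw [hΛ, Matrix.add_mulVec, Matrix.smul_mulVec, Matrix.smul_mulVec, Matrix.add_mulVec,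
      Matrix.one_mulVec, dotProduct_add, dotProduct_smul, dotProduct_smul, dotProduct_add, e1, e2,
      e3]
    generalize ∑ i, ∑ j, M i j * (star (z i) * z j) = w
    have := Complex.add_conj w
    simp only [smul_eq_mul, RCLike.star_def, this]
    push_cast; ring
  have hpd : Λ.PosDef := by
    refine Matrix.PosDef.of_dotProduct_mulVec_pos hh fun z hz => ?_
    rw [hq z]
    have h1 : 0 < ∑ i, ‖z i‖ ^ 2 := by
      obtain ⟨i, hi⟩ := Function.ne_iff.mp hz
      refine Finset.sum_pos' (fun _ _ => by positivity) ⟨i, Finset.mem_univ _, ?_⟩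
      have : 0 < ‖z i‖ := norm_pos_iff.mpr hi
      positivity
    have := hM z
    exact_mod_cast (by positivity)
  obtain ⟨B, hB⟩ := CStarAlgebra.nonneg_iff_eq_star_mul_self.mp hpd.posSemidef.nonneg
  rw [Matrix.star_eq_conjTranspose] at hB
  obtain ⟨W, hW⟩ := hpd.isUnit
  refine ⟨B, (↑W⁻¹ : Matrix (Fin n) (Fin n) ℂ) * B.conjTranspose, ?_, hB.symm⟩
  rw [mul_assoc, ← hB, ← hW, Units.inv_mul]

theorem qform_eval {E : Type*} [NormedAddCommGroup E] [InnerProductSpace ℂ E] {n : ℕ}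
    (M B : Matrix (Fin n) (Fin n) ℂ) (ε : ℝ)
    (h : B.conjTranspose * B = (2 : ℂ)⁻¹ • (M + M.conjTranspose) + (ε : ℂ) • 1) (ξ : Fin n → E) :
    ∑ i, ‖∑ j, B i j • ξ j‖ ^ 2 = (∑ i, ∑ j, M i j * ⟪ξ i, ξ j⟫).re + ε * ∑ i, ‖ξ i‖ ^ 2 := by
  have e1 : ((∑ i, ‖∑ j, B i j • ξ j‖ ^ 2 : ℝ) : ℂ) =
      ∑ i, ∑ j, (B.conjTranspose * B) i j * ⟪ξ i, ξ j⟫ := by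
    push_cast
    have : ∀ k, (‖∑ j, B k j • ξ j‖ : ℂ) ^ 2 = ∑ i, ∑ j, star (B k i) * B k j * ⟪ξ i, ξ j⟫ := by
      intro k
      have h0 : ⟪∑ j, B k j • ξ j, ∑ j, B k j • ξ j⟫ = (‖∑ j, B k j • ξ j‖ : ℂ) ^ 2 :=
        inner_self_eq_norm_sq_to_K _
      rw [← h0, sum_inner]
      refine Finset.sum_congr rfl fun i _ => ?_
      rw [inner_sum]
      refine Finset.sum_congr rfl fun j _ => ?_
      rw [inner_smul_left, inner_smul_right, RCLike.star_def]; ring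
    simp only [this]
    rw [Finset.sum_comm]
    refine Finset.sum_congr rfl fun i _ => ?_
    rw [Finset.sum_comm]
    refine Finset.sum_congr rfl fun j _ => ?_
    rw [Matrix.mul_apply, Finset.sum_mul]
    rfl
  have e2 : ∑ i, ∑ j, M.conjTranspose i j * ⟪ξ i, ξ j⟫ = star (∑ i, ∑ j, M i j * ⟪ξ i, ξ j⟫) := by
    simp only [star_sum]
    rw [Finset.sum_comm]
    refine Finset.sum_congr rfl fun i _ => Finset.sum_congr rfl fun j _ => ?_
    rw [Matrix.conjTranspose_apply, star_mul, mul_comm]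
    congr 1
    exact (inner_conj_symm _ _).symm
  have e3 : ∑ i, ∑ j, (1 : Matrix (Fin n) (Fin n) ℂ) i j * ⟪ξ i, ξ j⟫ =
      ((∑ i, ‖ξ i‖ ^ 2 : ℝ) : ℂ) := by
    simp [Matrix.one_apply]
  have e4 : ((∑ i, ‖∑ j, B i j • ξ j‖ ^ 2 : ℝ) : ℂ) =
      (2 : ℂ)⁻¹ * (∑ i, ∑ j, M i j * ⟪ξ i, ξ j⟫ + star (∑ i, ∑ j, M i j * ⟪ξ i, ξ j⟫)) +
        ε * ((∑ i, ‖ξ i‖ ^ 2 : ℝ) : ℂ) := by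
    rw [e1, h, ← e2, ← e3]
    simp only [Matrix.add_apply, Matrix.smul_apply, smul_eq_mul, Finset.mul_sum,
      ← Finset.sum_add_distrib]
    exact Finset.sum_congr rfl fun i _ => Finset.sum_congr rfl fun j _ => by ring
  have e5 := Complex.add_conj (∑ i, ∑ j, M i j * ⟪ξ i, ξ j⟫)
  rw [RCLike.star_def, e5] at e4
  apply Complex.ofReal_injective
  rw [e4]
  push_cast; ring

theorem key_pos {L H : Type*}
    [NormedAddCommGroup L] [InnerProductSpace ℂ L] [CompleteSpace L]
    [NormedAddCommGroup H] [InnerProductSpace ℂ H] [CompleteSpace H]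
    (N : VonNeumannAlgebra L)
    (π : (L →L[ℂ] L) →ₗ[ℂ] (H →L[ℂ] H))
    (C : ℝ) (hC : 0 ≤ C)
    (hcb : ∀ (n : ℕ) (a : Matrix (Fin n) (Fin n) (L →L[ℂ] L)), (∀ i j, a i j ∈ N) →
      ∀ S T, ImplementsMat a S → ImplementsMat (Matrix.of fun i j => π (a i j)) T →
        ‖T‖ ≤ C * ‖S‖)
    (l₀ : L) (hl₀ : ‖l₀‖ = 1)
    {n : ℕ} (M₁ M₂ : Matrix (Fin n) (Fin n) ℂ)
    (a : Matrix (Fin n) (Fin n) (L →L[ℂ] L)) (ha : ∀ i j, a i j ∈ N)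
    (hpos : ∀ ξ η : Fin n → L, 0 ≤ (∑ i, ∑ j, M₁ i j * ⟪ξ i, ξ j⟫ +
      ∑ i, ∑ j, M₂ i j * ⟪η i, η j⟫ + ∑ i, ∑ j, ⟪ξ i, a i j (η j)⟫).re) (u v : Fin n → H) :
    0 ≤ (C * ∑ i, ∑ j, M₁ i j * ⟪u i, u j⟫ + C * ∑ i, ∑ j, M₂ i j * ⟪v i, v j⟫ +
      ∑ i, ∑ j, ⟪u i, π (a i j) (v j)⟫).re := by
  have hll : ⟪l₀, l₀⟫ = 1 := by
    rw [inner_self_eq_norm_sq_to_K, hl₀]; simp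
  have hM₁ : ∀ z : Fin n → ℂ, 0 ≤ (∑ i, ∑ j, M₁ i j * (star (z i) * z j)).re := fun z => by
    have := hpos (fun i => z i • l₀) 0
    simp only [Pi.zero_apply, map_zero, inner_zero_right, inner_zero_left, inner_smul_left,
      inner_smul_right, hll, mul_zero, mul_one, Finset.sum_const_zero, add_zero, zero_add] at this
    refine this.trans_eq (congrArg Complex.re ?_)
    refine Finset.sum_congr rfl fun i _ => Finset.sum_congr rfl fun j _ => ?_
    rw [RCLike.star_def, mul_comm (z j)]
  have hM₂ : ∀ z : Fin n → ℂ, 0 ≤ (∑ i, ∑ j, M₂ i j * (star (z i) * z j)).re := fun z => by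
    have := hpos 0 (fun i => z i • l₀)
    simp only [Pi.zero_apply, map_zero, inner_zero_right, inner_zero_left, inner_smul_left,
      inner_smul_right, hll, mul_zero, mul_one, Finset.sum_const_zero, add_zero, zero_add] at this
    refine this.trans_eq (congrArg Complex.re ?_)
    refine Finset.sum_congr rfl fun i _ => Finset.sum_congr rfl fun j _ => ?_
    rw [RCLike.star_def, mul_comm (z j)]
  set R := ∑ i, ‖u i‖ ^ 2 + ∑ i, ‖v i‖ ^ 2 with hR
  have hR0 : 0 ≤ R := by positivity
  have main : ∀ ε : ℝ, 0 < ε → 0 ≤ (C * ∑ i, ∑ j, M₁ i j * ⟪u i, u j⟫ +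
      C * ∑ i, ∑ j, M₂ i j * ⟪v i, v j⟫ + ∑ i, ∑ j, ⟪u i, π (a i j) (v j)⟫).re + ε * (C * R) := by
    intro ε hε
    obtain ⟨B₁, D₁, h₁, f₁⟩ := qform_factor M₁ hM₁ ε hε
    obtain ⟨B₂, D₂, h₂, f₂⟩ := qform_factor M₂ hM₂ ε hε
    have := core_ineq N π C hC hcb B₁ B₂ D₁ D₂ h₁ h₂ a ha (fun ξ η => by
      rw [qform_eval M₁ B₁ ε f₁, qform_eval M₂ B₂ ε f₂]
      have h3 := hpos ξ η
      rw [Complex.add_re, Complex.add_re] at h3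
      have h4 : 0 ≤ ε * ∑ i, ‖ξ i‖ ^ 2 := by positivity
      have h5 : 0 ≤ ε * ∑ i, ‖η i‖ ^ 2 := by positivity
      linarith) u v
    rw [qform_eval M₁ B₁ ε f₁, qform_eval M₂ B₂ ε f₂] at this
    rw [Complex.add_re, Complex.add_re, Complex.re_ofReal_mul, Complex.re_ofReal_mul]
    rw [hR]
    linarith
  by_contra hneg
  push Not at hneg
  set X := (C * ∑ i, ∑ j, M₁ i j * ⟪u i, u j⟫ +
      C * ∑ i, ∑ j, M₂ i j * ⟪v i, v j⟫ + ∑ i, ∑ j, ⟪u i, π (a i j) (v j)⟫).re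
  have hCR : 0 ≤ C * R := by positivity
  have h := main (-X / (2 * (C * R + 1))) (div_pos (by linarith) (by positivity))
  have h2 : -X / (2 * (C * R + 1)) * (C * R) ≤ -X / 2 := by
    rw [div_mul_eq_mul_div, div_le_div_iff₀ (by positivity) (by norm_num)]
    nlinarith
  linarith

set_option maxHeartbeats 1000000 in
theorem riesz_kernel {P L : Type*} [NormedAddCommGroup L] [InnerProductSpace ℂ L]
    [CompleteSpace L] (d : P → P → Submodule ℂ (L →L[ℂ] L))
    (φ : P → P → (L →L[ℂ] L) →ₗ[ℂ] ℂ) (hd1 : ∀ p, 1 ∈ d p p)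
    (hpos : ∀ A : (P × P) →₀ (L →L[ℂ] L), (∀ p q, A (p, q) ∈ d p q) →
      (∀ ξ : P → L, 0 ≤ (A.sum fun pq a => ⟪ξ pq.1, a (ξ pq.2)⟫).re) →
      0 ≤ (A.sum fun pq a => φ pq.1 pq.2 a).re) :
    ∃ G : P → P → (L →L[ℂ] L) →ₗ[ℂ] ℂ, (∀ p q a, G q p (star a) = star (G p q a)) ∧
      (∀ m : L →L[ℂ] L, (∀ l, 0 ≤ (⟪l, m l⟫).re) → ∀ x : P →₀ (L →L[ℂ] L),
        0 ≤ (x.sum fun p xp => x.sum fun q xq => G p q (star xp * m * xq)).re) ∧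
      ∀ p q a, a ∈ d p q → G p q a = φ p q a := by
  classical
  let ev : L → L → (L →L[ℂ] L) →ₗ[ℂ] ℂ := fun x y =>
    { toFun := fun a => ⟪x, a y⟫
      map_add' := fun a b => by simp [inner_add_right]
      map_smul' := fun c a => by simp [inner_smul_right] }
  have hev : ∀ x y a, ev x y a = ⟪x, a y⟫ := fun _ _ _ => rfl
  let Q : (P → L) → ((P × P) →₀ (L →L[ℂ] L)) →ₗ[ℂ] ℂ := fun ξ =>
    Finsupp.lsum ℂ fun pq => ev (ξ pq.1) (ξ pq.2)
  have hQ : ∀ ξ A, Q ξ A = A.sum fun pq a => ⟪ξ pq.1, a (ξ pq.2)⟫ := fun ξ A => by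
    simp only [Q, Finsupp.lsum_apply]; rfl
  have hQs : ∀ ξ p q a, Q ξ (Finsupp.single (p, q) a) = ⟪ξ p, a (ξ q)⟫ := fun ξ p q a => by
    rw [hQ, Finsupp.sum_single_index (by simp)]
  let Φ : ((P × P) →₀ (L →L[ℂ] L)) →ₗ[ℂ] ℂ := Finsupp.lsum ℂ fun pq => φ pq.1 pq.2
  have hΦ : ∀ A, Φ A = A.sum fun pq a => φ pq.1 pq.2 a := fun A => by
    simp only [Φ, Finsupp.lsum_apply]
  let s : PointedCone ℝ ((P × P) →₀ (L →L[ℂ] L)) :=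
    { carrier := {A | ∀ ξ, 0 ≤ (Q ξ A).re}
      zero_mem' := fun ξ => by simp
      add_mem' := fun {A B} hA hB ξ => by
        rw [map_add, Complex.add_re]; exact add_nonneg (hA ξ) (hB ξ)
      smul_mem' := fun r A hA ξ => by
        change 0 ≤ (Q ξ ((r : ℝ) • A)).re
        rw [← Complex.coe_smul, map_smul, smul_eq_mul, Complex.re_ofReal_mul]
        exact mul_nonneg r.2 (hA ξ) }
  have hs : ∀ A, A ∈ s ↔ ∀ ξ, 0 ≤ (Q ξ A).re := fun A => Iff.rfl
  let D : Submodule ℂ ((P × P) →₀ (L →L[ℂ] L)) :=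
    { carrier := {A | ∀ p q, A (p, q) ∈ d p q}
      zero_mem' := fun p q => zero_mem _
      add_mem' := fun hA hB p q => add_mem (hA p q) (hB p q)
      smul_mem' := fun c A hA p q => (d p q).smul_mem c (hA p q) }
  have hDs : ∀ p q a, a ∈ d p q → Finsupp.single (p, q) a ∈ D := fun p q a ha p' q' => by
    rw [Finsupp.single_apply]
    split_ifs with h
    · obtain ⟨rfl, rfl⟩ := Prod.mk.inj h
      exact ha
    · exact zero_mem _
  let f : ((P × P) →₀ (L →L[ℂ] L)) →ₗ.[ℝ] ℝ :=
    ⟨D.restrictScalars ℝ, (Complex.reLm ∘ₗ (Φ.restrictScalars ℝ)).domRestrict _⟩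
  obtain ⟨g, hg1, hg2⟩ := riesz_extension s f (fun x hx => by
      change 0 ≤ (Φ x).re
      rw [hΦ]
      refine hpos x (fun p q => x.2 p q) fun ξ => ?_
      rw [← hQ]; exact hx ξ) (fun y => by
      let T : Finset P := y.support.image Prod.fst ∪ y.support.image Prod.snd
      let c : ℝ := ∑ pq ∈ y.support, ‖y pq‖
      refine ⟨⟨∑ p ∈ T, Finsupp.single (p, p) ((c : ℂ) • (1 : L →L[ℂ] L)), ?_⟩, ?_⟩
      · change _ ∈ D
        exact sum_mem fun p _ => hDs p p _ ((d p p).smul_mem _ (hd1 p))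
      · rw [hs]
        intro ξ
        change 0 ≤ (Q ξ (∑ p ∈ T, Finsupp.single (p, p) ((c : ℂ) • (1 : L →L[ℂ] L)) + y)).re
        have e1 : (Q ξ (∑ p ∈ T, Finsupp.single (p, p) ((c : ℂ) • (1 : L →L[ℂ] L)))).re =
            c * ∑ p ∈ T, ‖ξ p‖ ^ 2 := by
          rw [map_sum, Complex.re_sum, Finset.mul_sum]
          refine Finset.sum_congr rfl fun p _ => ?_
          rw [hQs]
          change (⟪ξ p, (c : ℂ) • ξ p⟫).re = _
          rw [inner_smul_right, Complex.re_ofReal_mul]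
          congr 1
          exact inner_self_eq_norm_sq (𝕜 := ℂ) (ξ p)
        have e2 : |(Q ξ y).re| ≤ c * ∑ p ∈ T, ‖ξ p‖ ^ 2 := by
          refine (Complex.abs_re_le_norm _).trans ?_
          rw [hQ, Finsupp.sum, Finset.sum_mul]
          refine norm_sum_le_of_le _ fun pq hpq => ?_
          have hp : ‖ξ pq.1‖ ^ 2 ≤ ∑ p ∈ T, ‖ξ p‖ ^ 2 :=
            Finset.single_le_sum (f := fun p => ‖ξ p‖ ^ 2) (fun _ _ => by positivity)
              (Finset.mem_union_left _ (Finset.mem_image_of_mem _ hpq))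
          have hq : ‖ξ pq.2‖ ^ 2 ≤ ∑ p ∈ T, ‖ξ p‖ ^ 2 :=
            Finset.single_le_sum (f := fun p => ‖ξ p‖ ^ 2) (fun _ _ => by positivity)
              (Finset.mem_union_right _ (Finset.mem_image_of_mem _ hpq))
          calc ‖⟪ξ pq.1, y pq (ξ pq.2)⟫‖ ≤ ‖ξ pq.1‖ * (‖y pq‖ * ‖ξ pq.2‖) :=
                (norm_inner_le_norm _ _).trans (by gcongr; exact (y pq).le_opNorm _)
            _ = ‖y pq‖ * (‖ξ pq.1‖ * ‖ξ pq.2‖) := by ring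
            _ ≤ _ := by
              gcongr
              nlinarith [sq_nonneg (‖ξ pq.1‖ - ‖ξ pq.2‖)]
        rw [map_add, Complex.add_re, e1]
        have := neg_le_of_abs_le e2
        linarith)
  have hgD : ∀ A ∈ D, g A = (Φ A).re := fun A hA => hg1 ⟨A, hA⟩
  let g' : ((P × P) →₀ (L →L[ℂ] L)) →ₗ[ℂ] ℂ := Module.Dual.extendRCLike (𝕜 := ℂ) g
  have hre : ∀ A, (g' A).re = g A := fun A => Module.Dual.re_extendRCLike_apply (𝕜 := ℂ) g A
  have him : ∀ A, (g' A).im = - g (Complex.I • A) := fun A =>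
    Module.Dual.im_extendRCLike_apply (𝕜 := ℂ) g A
  have hherm : ∀ p q a, g (Finsupp.single (q, p) (star a)) = g (Finsupp.single (p, q) a) := by
    intro p q a
    have key : ∀ ξ, (Q ξ (Finsupp.single (q, p) (star a))).re =
        (Q ξ (Finsupp.single (p, q) a)).re := fun ξ => by
      rw [hQs, hQs, ContinuousLinearMap.star_eq_adjoint, ContinuousLinearMap.adjoint_inner_right,
        ← inner_conj_symm, Complex.conj_re]
    apply le_antisymm
    · have := hg2 (Finsupp.single (p, q) a - Finsupp.single (q, p) (star a)) (fun ξ => by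
        rw [map_sub, Complex.sub_re, key, sub_self])
      rw [map_sub] at this
      linarith
    · have := hg2 (Finsupp.single (q, p) (star a) - Finsupp.single (p, q) a) (fun ξ => by
        rw [map_sub, Complex.sub_re, key, sub_self])
      rw [map_sub] at this
      linarith
  refine ⟨fun p q => g' ∘ₗ Finsupp.lsingle (p, q), fun p q a => ?_, fun m hm x => ?_,
    fun p q a ha => ?_⟩
  · change g' (Finsupp.single (q, p) (star a)) = star (g' (Finsupp.single (p, q) a))
    apply Complex.ext
    · rw [hre, RCLike.star_def, Complex.conj_re, hre, hherm]
    · rw [him, RCLike.star_def, Complex.conj_im, him, Finsupp.smul_single, Finsupp.smul_single]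
      have h1 : Complex.I • star a = star (-(Complex.I • a)) := by
        rw [star_neg, star_smul, RCLike.star_def, Complex.conj_I, neg_smul, neg_neg]
      rw [h1, hherm, Finsupp.single_neg, map_neg]
  · have e1 : (x.sum fun p xp => x.sum fun q xq =>
        (g' ∘ₗ Finsupp.lsingle (p, q)) (star xp * m * xq)) =
        g' (x.sum fun p xp => x.sum fun q xq => Finsupp.single (p, q) (star xp * m * xq)) := by
      simp only [Finsupp.sum, map_sum]; rfl
    rw [e1, hre]
    refine hg2 _ fun ξ => ?_
    have e2 : Q ξ (x.sum fun p xp => x.sum fun q xq => Finsupp.single (p, q) (star xp * m * xq)) =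
        ⟪∑ p ∈ x.support, x p (ξ p), m (∑ p ∈ x.support, x p (ξ p))⟫ := by
      simp only [Finsupp.sum, map_sum, hQs, sum_inner, inner_sum]
      rw [Finset.sum_comm]
      refine Finset.sum_congr rfl fun p _ => Finset.sum_congr rfl fun q _ => ?_
      change ⟪ξ q, (star (x q)) (m (x p (ξ p)))⟫ = _
      rw [ContinuousLinearMap.star_eq_adjoint, ContinuousLinearMap.adjoint_inner_right]
    rw [e2]
    exact hm _
  · change g' (Finsupp.single (p, q) a) = φ p q a
    have hm := hDs p q a ha
    have h1 : Φ (Finsupp.single (p, q) a) = φ p q a := by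
      rw [hΦ, Finsupp.sum_single_index (by simp)]
    rw [← h1]
    apply Complex.ext
    · rw [hre, hgD _ hm]
    · rw [him, hgD _ (D.smul_mem _ hm), map_smul]
      simp

theorem finsupp_sum_of_inj {ι κ M R : Type*} [Fintype κ] [AddCommMonoid M] [AddCommMonoid R]
    (g : κ → ι) (hg : Function.Injective g) (A : ι →₀ M) (hA : ∀ i ∈ A.support, i ∈ Set.range g)
    (h : ι → M → R) (h0 : ∀ i, h i 0 = 0) : A.sum h = ∑ k, h (g k) (A (g k)) := by
  classical
  rw [← Finset.sum_image (f := fun i => h i (A i)) (s := Finset.univ) (g := g) (fun a _ b _ e => hg e)]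
  refine Finset.sum_subset (fun i hi => ?_) (fun i _ hi => ?_)
  · obtain ⟨k, rfl⟩ := hA i hi
    exact Finset.mem_image_of_mem _ (Finset.mem_univ _)
  · rw [Finsupp.notMem_support_iff.mp hi, h0]

theorem sum_pairs {n : ℕ} {R : Type*} [AddCommMonoid R]
    (F : (Fin n ⊕ Fin n) × (Fin n ⊕ Fin n) → R) :
    ∑ k, F k = (∑ i, ∑ j, F (Sum.inl i, Sum.inl j) + ∑ i, ∑ j, F (Sum.inl i, Sum.inr j)) +
      (∑ i, ∑ j, F (Sum.inr i, Sum.inl j) + ∑ i, ∑ j, F (Sum.inr i, Sum.inr j)) := by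
  rw [Fintype.sum_prod_type, Fintype.sum_sum_type]
  simp only [Fintype.sum_sum_type, Finset.sum_add_distrib]

set_option maxHeartbeats 1000000 in
theorem exists_kernel {L H : Type*}
    [NormedAddCommGroup L] [InnerProductSpace ℂ L] [CompleteSpace L]
    [NormedAddCommGroup H] [InnerProductSpace ℂ H] [CompleteSpace H]
    (N : VonNeumannAlgebra L)
    (π : (L →L[ℂ] L) →ₗ[ℂ] (H →L[ℂ] H))
    (C : ℝ) (hC : 0 ≤ C)
    (hcb : ∀ (n : ℕ) (a : Matrix (Fin n) (Fin n) (L →L[ℂ] L)), (∀ i j, a i j ∈ N) →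
      ∀ S T, ImplementsMat a S → ImplementsMat (Matrix.of fun i j => π (a i j)) T →
        ‖T‖ ≤ C * ‖S‖)
    (l₀ : L) (hl₀ : ‖l₀‖ = 1) :
    ∃ G : H ⊕ H → H ⊕ H → (L →L[ℂ] L) →ₗ[ℂ] ℂ,
      (∀ p q a, G q p (star a) = star (G p q a)) ∧
      (∀ m : L →L[ℂ] L, (∀ l, 0 ≤ (⟪l, m l⟫).re) → ∀ x : H ⊕ H →₀ (L →L[ℂ] L),
        0 ≤ (x.sum fun p xp => x.sum fun q xq => G p q (star xp * m * xq)).re) ∧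
      (∀ u v, G (Sum.inl u) (Sum.inl v) 1 = C * ⟪u, v⟫) ∧
      (∀ u v, G (Sum.inr u) (Sum.inr v) 1 = C * ⟪u, v⟫) ∧
      ∀ u v, ∀ a ∈ N, G (Sum.inl u) (Sum.inr v) a = ⟪u, π a v⟫ := by
  classical
  have hll : ⟪l₀, l₀⟫ = 1 := by
    rw [inner_self_eq_norm_sq_to_K, hl₀]; simp
  let d : H ⊕ H → H ⊕ H → Submodule ℂ (L →L[ℂ] L) := fun p q => match p, q with
    | Sum.inl _, Sum.inl _ => Submodule.span ℂ {1}
    | Sum.inr _, Sum.inr _ => Submodule.span ℂ {1}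
    | Sum.inl _, Sum.inr _ => Subalgebra.toSubmodule N.toStarSubalgebra.toSubalgebra
    | Sum.inr _, Sum.inl _ => ⊥
  let σ : H → H → (L →L[ℂ] L) →ₗ[ℂ] ℂ := fun u v =>
    { toFun := fun a => C * ⟪u, v⟫ * ⟪l₀, a l₀⟫
      map_add' := fun a b => by simp [mul_add]
      map_smul' := fun c a => by simp; ring }
  let τ : H → H → (L →L[ℂ] L) →ₗ[ℂ] ℂ := fun u v =>
    { toFun := fun a => ⟪u, π a v⟫
      map_add' := fun a b => by simp
      map_smul' := fun c a => by simp }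
  let φ : H ⊕ H → H ⊕ H → (L →L[ℂ] L) →ₗ[ℂ] ℂ := fun p q => match p, q with
    | Sum.inl u, Sum.inl v => σ u v
    | Sum.inr u, Sum.inr v => σ u v
    | Sum.inl u, Sum.inr v => τ u v
    | Sum.inr _, Sum.inl _ => 0
  have hσ : ∀ u v (z : ℂ), σ u v (z • 1) = C * (z * ⟪u, v⟫) := fun u v z => by
    change C * ⟪u, v⟫ * ⟪l₀, z • l₀⟫ = _
    rw [inner_smul_right, hll]; ring
  obtain ⟨G, h1, h2, h3⟩ := riesz_kernel d φ (fun p => by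
    cases p <;> exact Submodule.mem_span_singleton_self _) (fun A hAd hA => by
    let lab : H ⊕ H → H := Sum.elim id id
    let T : Finset H := A.support.image (fun pq => lab pq.1) ∪ A.support.image (fun pq => lab pq.2)
    let e := T.equivFin.symm
    let u : Fin T.card → H := fun i => (e i : H)
    have hu : Function.Injective u := Subtype.val_injective.comp e.injective
    have hur : ∀ x ∈ T, ∃ i, u i = x := fun x hx => ⟨e.symm ⟨x, hx⟩, by simp [u]⟩
    let κ : Fin T.card ⊕ Fin T.card → H ⊕ H := Sum.map u u
    have hκ : Function.Injective κ := hu.sumMap hu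
    have hκr : ∀ p, lab p ∈ T → ∃ k, κ k = p := fun p hp => by
      obtain ⟨i, hi⟩ := hur _ hp
      rcases p with p | p
      · exact ⟨Sum.inl i, congrArg Sum.inl hi⟩
      · exact ⟨Sum.inr i, congrArg Sum.inr hi⟩
    have hsupp : ∀ pq ∈ A.support, pq ∈ Set.range (Prod.map κ κ) := fun pq hpq => by
      obtain ⟨k, hk⟩ := hκr pq.1 (Finset.mem_union_left _
        (Finset.mem_image_of_mem (fun pq : (H ⊕ H) × (H ⊕ H) => lab pq.1) hpq))
      obtain ⟨k', hk'⟩ := hκr pq.2 (Finset.mem_union_right _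
        (Finset.mem_image_of_mem (fun pq : (H ⊕ H) × (H ⊕ H) => lab pq.2) hpq))
      exact ⟨(k, k'), Prod.ext hk hk'⟩
    have z1 : ∀ i j, ∃ z : ℂ, z • (1 : L →L[ℂ] L) = A (Sum.inl (u i), Sum.inl (u j)) := fun i j =>
      Submodule.mem_span_singleton.mp (hAd (Sum.inl (u i)) (Sum.inl (u j)))
    have z2 : ∀ i j, ∃ z : ℂ, z • (1 : L →L[ℂ] L) = A (Sum.inr (u i), Sum.inr (u j)) := fun i j =>
      Submodule.mem_span_singleton.mp (hAd (Sum.inr (u i)) (Sum.inr (u j)))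
    choose M₁ hM₁ using z1
    choose M₂ hM₂ using z2
    have h0 : ∀ i j, A (Sum.inr (u i), Sum.inl (u j)) = 0 := fun i j =>
      (Submodule.mem_bot ℂ).mp (hAd (Sum.inr (u i)) (Sum.inl (u j)))
    have ha : ∀ i j, A (Sum.inl (u i), Sum.inr (u j)) ∈ N := fun i j =>
      hAd (Sum.inl (u i)) (Sum.inr (u j))
    have hfin := key_pos N π C hC hcb l₀ hl₀ M₁ M₂
      (fun i j => A (Sum.inl (u i), Sum.inr (u j))) ha (fun ξ η => by
        have h := hA (Sum.elim (Function.extend u ξ 0) (Function.extend u η 0))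
        rw [finsupp_sum_of_inj (Prod.map κ κ) (hκ.prodMap hκ) A hsupp _ (fun i => by simp),
          sum_pairs] at h
        simp only [Prod.map_apply, κ, Sum.map_inl, Sum.map_inr, Sum.elim_inl, Sum.elim_inr,
          hu.extend_apply, h0, ← hM₁, ← hM₂] at h
        refine h.trans_eq (congrArg Complex.re ?_)
        simp [inner_smul_right]
        ring) u u
    rw [finsupp_sum_of_inj (Prod.map κ κ) (hκ.prodMap hκ) A hsupp _ (fun i => map_zero _),
      sum_pairs]
    refine hfin.trans_eq (congrArg Complex.re ?_)
    simp only [Prod.map_apply, κ, Sum.map_inl, Sum.map_inr, h0, ← hM₁, ← hM₂, φ, hσ, map_zero,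
      Finset.sum_const_zero, zero_add, Finset.mul_sum]
    have : ∀ i j, τ (u i) (u j) (A (Sum.inl (u i), Sum.inr (u j))) =
      ⟪u i, π (A (Sum.inl (u i), Sum.inr (u j))) (u j)⟫ := fun _ _ => rfl
    simp only [this]
    ring)
  refine ⟨G, h1, h2, fun u v => ?_, fun u v => ?_, fun u v a ha => ?_⟩
  · rw [h3 _ _ _ (show (1 : L →L[ℂ] L) ∈ d (Sum.inl u) (Sum.inl v) from
      Submodule.mem_span_singleton_self _)]
    simpa using hσ u v 1
  · rw [h3 _ _ _ (show (1 : L →L[ℂ] L) ∈ d (Sum.inr u) (Sum.inr v) from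
      Submodule.mem_span_singleton_self _)]
    simpa using hσ u v 1
  · rw [h3 _ _ _ (show a ∈ d (Sum.inl u) (Sum.inr v) from ha)]
    rfl

theorem exists_clm_of_gram {H K : Type*} [NormedAddCommGroup H] [InnerProductSpace ℂ H]
    [NormedAddCommGroup K] [InnerProductSpace ℂ K] (C : ℝ) (hC : 0 ≤ C) (v : H → K)
    (hv : ∀ u w, ⟪v u, v w⟫ = C * ⟪u, w⟫) : ∃ V : H →L[ℂ] K, ∀ u, V u = v u := by
  have hadd : ∀ x y, v (x + y) = v x + v y := fun x y => by
    rw [← sub_eq_zero, ← inner_self_eq_zero (𝕜 := ℂ)]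
    simp only [inner_sub_left, inner_sub_right, inner_add_left, inner_add_right, hv]
    ring
  have hsmul : ∀ (c : ℂ) x, v (c • x) = c • v x := fun c x => by
    rw [← sub_eq_zero, ← inner_self_eq_zero (𝕜 := ℂ)]
    simp only [inner_sub_left, inner_sub_right, inner_smul_left, inner_smul_right, hv]
    ring
  let V₀ : H →ₗ[ℂ] K := { toFun := v, map_add' := hadd, map_smul' := hsmul }
  refine ⟨V₀.mkContinuous (Real.sqrt C) fun x => ?_, fun u => rfl⟩
  refine le_of_sq_le_sq ?_ (by positivity)
  rw [mul_pow, Real.sq_sqrt hC]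
  have h1 := congrArg Complex.re (hv x x)
  rw [Complex.re_ofReal_mul] at h1
  have h2 : (⟪v x, v x⟫).re = ‖v x‖ ^ 2 := inner_self_eq_norm_sq (𝕜 := ℂ) (v x)
  have h3 : (⟪x, x⟫).re = ‖x‖ ^ 2 := inner_self_eq_norm_sq (𝕜 := ℂ) x
  rw [h2, h3] at h1
  exact h1.le

/-- extension of normal cb maps through a type I factor: if `N ⊆ B(L) = F`
is a von Neumann subalgebra of the type I factor `F` and `π : N → B(H)` is a completely
bounded normal map, then `π` extends to a completely bounded normal map
`π~ : B(L) → B(H)` with `π~|_N = π`. -/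
theorem stmt_10
    {L H : Type*}
    [NormedAddCommGroup L] [InnerProductSpace ℂ L] [CompleteSpace L]
    [NormedAddCommGroup H] [InnerProductSpace ℂ H] [CompleteSpace H]
    (N : VonNeumannAlgebra L)
    (π : (L →L[ℂ] L) →ₗ[ℂ] (H →L[ℂ] H))
    (C : ℝ)
    -- `π` is completely bounded on `N`
    (hcb : ∀ (n : ℕ) (a : Matrix (Fin n) (Fin n) (L →L[ℂ] L)), (∀ i j, a i j ∈ N) →
      ∀ S T, ImplementsMat a S → ImplementsMat (Matrix.of fun i j => π (a i j)) T →
        ‖T‖ ≤ C * ‖S‖)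
    -- `π` is normal on `N`
    (hnormal : ∀ u w : H, IsNormalForm (N : Set (L →L[ℂ] L)) fun x => ⟪w, π x u⟫) :
    ∃ (πt : (L →L[ℂ] L) →ₗ[ℂ] (H →L[ℂ] H)) (C' : ℝ),
      -- `πt` is completely bounded on all of `F = B(L)`
      (∀ (n : ℕ) (a : Matrix (Fin n) (Fin n) (L →L[ℂ] L)),
        ∀ S T, ImplementsMat a S → ImplementsMat (Matrix.of fun i j => πt (a i j)) T →
          ‖T‖ ≤ C' * ‖S‖) ∧
      -- `πt` is normal on all of `F = B(L)`
      (∀ u w : H, IsNormalForm (Set.univ : Set (L →L[ℂ] L)) fun x => ⟪w, πt x u⟫) ∧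
      -- `πt` extends `π`
      (∀ x ∈ N, πt x = π x) := by
  classical
  rcases subsingleton_or_nontrivial L with hL | hL
  · have hx : ∀ x : L →L[ℂ] L, x = 0 := fun x => ContinuousLinearMap.ext fun l =>
      Subsingleton.elim _ _
    refine ⟨0, 0, fun n a S T hS hT => ?_, fun u w => ⟨0, 0, ?_, ?_, fun x _ => ?_⟩, fun x _ => ?_⟩
    · have hT0 : T = 0 := by
        ext ξ i
        have := hT ξ i
        simpa using this
      simp [hT0]
    · simp
    · simp
    · simpa using hasSum_zero
    · rw [hx x, map_zero, map_zero]
  · obtain ⟨l₁, hl₁⟩ := exists_ne (0 : L)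
    have hl₀ : ‖((‖l₁‖ : ℂ)⁻¹) • l₁‖ = 1 := norm_smul_inv_norm hl₁
    have hC : 0 ≤ |C| := abs_nonneg C
    obtain ⟨G, herm, pos, g1, g2, g3⟩ := exists_kernel N π |C| hC
      (fun n a ha S T hS hT => (hcb n a ha S T hS hT).trans
        (mul_le_mul_of_nonneg_right (le_abs_self C) (norm_nonneg _))) _ hl₀
    obtain ⟨K, j1, j2, j3, ρ, v, hv, hstar, hmul, hone⟩ := stinespring G herm pos
    have hv1 : ∀ p q, ⟪v p, v q⟫ = G p q 1 := fun p q => by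
      rw [← hv p q 1, hone]; rfl
    obtain ⟨V₁, hV₁⟩ := exists_clm_of_gram |C| hC (fun u => v (Sum.inl u))
      (fun u w => (hv1 _ _).trans (g1 u w))
    obtain ⟨V₂, hV₂⟩ := exists_clm_of_gram |C| hC (fun u => v (Sum.inr u))
      (fun u w => (hv1 _ _).trans (g2 u w))
    obtain ⟨J, Y₁, Y₂, hY⟩ := exists_normal_dilation N ρ hstar hmul hone V₁ V₂ (fun a => π a)
      (fun a ha u w => by rw [hV₁, hV₂, hv, g3 _ _ _ ha]) hnormal
    obtain ⟨πt, C', hc, hn, hf⟩ := ext_of_dilation Y₁ Y₂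
    refine ⟨πt, C', hc, hn, fun x hx => ?_⟩
    ext u
    refine ext_inner_left ℂ fun w => ?_
    rw [hf, hY x hx u w]
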